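/- arXiv:1903.01315 — 2 statements merged into one kernel-verified Lean document; each statement's English description precedes it below -/
import Mathlib

section
/- Let x_1, ..., x_d and y_1, ..., y_d be two C-systems of parameters of M. Then ir_M((x_1,...,x_d)) = ir_M((y_1,...,y_d)); that is, the index of reducibility on M of the ideal generated by a C-system of parameters of M is independent of the choice of the C-system of parameters. -/
open IsLocalRing

universe u

namespace Paper

variable (R : Type u) [CommRing R]

/-- `dim_{R/I} Soc_I(N)` where `Soc_I(N) = (0 :_N I)`. -/
noncomputable def socDim (I : Ideal R) (N : Type u) [AddCommGroup N] [Module R N] : ℕ :=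
  Module.finrank (R ⧸ I) (Submodule.torsionBySet R N (I : Set R))

/-- Krull dimension of a module (`⊥` for the zero module). -/
noncomputable def mdim (M : Type u) [AddCommGroup M] [Module R M] : WithBot (WithTop ℕ) :=
  ringKrullDim (R ⧸ Module.annihilator R M)

/-- The index of reducibility of an ideal `q` on `M`: `dim_k Soc (M/qM)`. -/
noncomputable def ir [IsLocalRing R] (M : Type u) [AddCommGroup M] [Module R M]
    (q : Ideal R) : ℕ :=
  socDim R (maximalIdeal R) (M ⧸ (q • ⊤ : Submodule R M))

/-- A system of parameters of `M` (of length `d`): `d` elements of the maximal ideal such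
that the quotient has finite length. -/
def IsSOP [IsLocalRing R] (M : Type u) [AddCommGroup M] [Module R M] (d : ℕ)
    (x : Fin d → R) : Prop :=
  (∀ i, x i ∈ maximalIdeal R) ∧
    IsFiniteLength R (M ⧸ (Ideal.span (Set.range x) • ⊤ : Submodule R M))

/-- The ideal `b(M) = ⋂ Ann (0 :_{M/(x_1,...,x_{i-1})M} x_i)`, the intersection running over
all systems of parameters `x_1, ..., x_d` of `M`. -/
noncomputable def bIdeal [IsLocalRing R] (M : Type u) [AddCommGroup M] [Module R M]
    (d : ℕ) : Ideal R :=
  ⨅ (x : Fin d → R) (_ : IsSOP R M d x) (i : Fin d),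
    Module.annihilator R
      (Submodule.torsionBy R (M ⧸ (Ideal.span (x '' {j | j < i}) • ⊤ : Submodule R M)) (x i))

/-- A C-system of parameters: `x_i ∈ b(M/(x_{i+1},...,x_d)M)^3` for all `i`. -/
def IsCSOP [IsLocalRing R] (M : Type u) [AddCommGroup M] [Module R M] (d : ℕ)
    (x : Fin d → R) : Prop :=
  IsSOP R M d x ∧ ∀ i : Fin d,
    x i ∈ (bIdeal R (M ⧸ (Ideal.span (x '' {j | i < j}) • ⊤ : Submodule R M)) ((i : ℕ) + 1)) ^ 3

/-- The depth of `M`: the supremum of the lengths of `M`-regular sequences contained in the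
maximal ideal. -/
noncomputable def depth [IsLocalRing R] (M : Type u) [AddCommGroup M] [Module R M] :
    WithTop ℕ :=
  sSup {n : WithTop ℕ | ∃ rs : List R, (rs.length : WithTop ℕ) = n ∧
    (∀ r ∈ rs, r ∈ maximalIdeal R) ∧ RingTheory.Sequence.IsRegular M rs}

/-- `M` is a Cohen-Macaulay module: `depth M = dim M`. -/
def IsCM [IsLocalRing R] (M : Type u) [AddCommGroup M] [Module R M] : Prop :=
  (depth R M : WithBot (WithTop ℕ)) = mdim R M

/-- A Cohen-Macaulay local ring. -/
def IsCMLocalRing (S : Type u) [CommRing S] [IsLocalRing S] : Prop :=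
  IsNoetherianRing S ∧ IsCM S S

/-- `R` is a homomorphic image of a Cohen-Macaulay (Noetherian) local ring. -/
def IsQuotientOfCMLocalRing : Prop :=
  ∃ (S : Type u) (_ : CommRing S) (_ : IsLocalRing S),
    IsCMLocalRing S ∧ ∃ f : S →+* R, Function.Surjective f

end Paper

open Paper

namespace Paper

section Key

variable {R : Type u} [CommRing R]

lemma mem_right_of_mem_mul {I J : Ideal R} {a : R} (h : a ∈ I * J) : a ∈ J :=
  (Ideal.mul_le_inf h).2

lemma mem_left_of_mem_mul {I J : Ideal R} {a : R} (h : a ∈ I * J) : a ∈ I :=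
  (Ideal.mul_le_inf h).1

lemma socDim_eq_of_equiv (I : Ideal R) {N N' : Type u} [AddCommGroup N] [Module R N]
    [AddCommGroup N'] [Module R N']
    (e : Submodule.torsionBySet R N (I : Set R) ≃ₗ[R] Submodule.torsionBySet R N' (I : Set R)) :
    socDim R I N = socDim R I N' := by
  unfold socDim
  exact LinearEquiv.finrank_eq
    (LinearEquiv.extendScalarsOfSurjective (R := R) (S := R ⧸ I)
      Ideal.Quotient.mk_surjective e)

lemma socDim_congr (I : Ideal R) {N N' : Type u} [AddCommGroup N] [Module R N]
    [AddCommGroup N'] [Module R N'] (e : N ≃ₗ[R] N') : socDim R I N = socDim R I N' := by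
  apply socDim_eq_of_equiv
  refine (e.submoduleMap _).trans (LinearEquiv.ofEq _ _ ?_)
  ext n
  simp only [Submodule.mem_map, Submodule.mem_torsionBySet_iff]
  constructor
  · rintro ⟨a, ha, rfl⟩ r
    have h := ha r
    calc (r : R) • e a = e ((r : R) • a) := (map_smul e _ _).symm
      _ = 0 := by rw [h, map_zero]
  · intro h
    refine ⟨e.symm n, fun r => ?_, by simp⟩
    rw [← map_smul, h r, map_zero]

variable {N : Type u} [AddCommGroup N] [Module R N]

lemma exists_lift (m b : Ideal R) (U : Submodule R N) (hb : ∀ p ∈ b, ∀ n ∈ U, p • n = 0)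
    (w : R) (hw : w ∈ b * m) :
    ∃ L : (m →ₗ[R] N ⧸ U) →ₗ[R] N,
      (∀ φ (h : w ∈ m), U.mkQ (L φ) = φ ⟨w, h⟩) ∧
      (∀ φ n, (∀ r : m, φ r = U.mkQ ((r : R) • n)) → L φ = w • n) ∧
      (∀ φ (r : m) n, U.mkQ n = φ r → (r : R) • L φ = w • n) := by
  induction hw using Submodule.mul_induction_on' with
  | mem_mul_mem p hp q hq =>
    let β : N ⧸ U →ₗ[R] N := U.liftQ (LinearMap.lsmul R N p) (fun n hn => by
      simpa using hb p hp n hn)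
    have hβ : ∀ n, β (U.mkQ n) = p • n := fun n => by simp [β]
    have hβ' : ∀ n, U.mkQ (β n) = p • n := fun n => by
      obtain ⟨n, rfl⟩ := U.mkQ_surjective n
      rw [hβ, map_smul]
    refine ⟨β ∘ₗ LinearMap.applyₗ (⟨q, hq⟩ : m), ?_, ?_, ?_⟩
    · intro φ h
      simp only [LinearMap.comp_apply, LinearMap.applyₗ_apply_apply]
      rw [hβ', ← map_smul]
      rfl
    · intro φ n h
      simp only [LinearMap.comp_apply, LinearMap.applyₗ_apply_apply]
      rw [h, hβ, mul_smul]
    · intro φ r n h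
      simp only [LinearMap.comp_apply, LinearMap.applyₗ_apply_apply]
      rw [mul_smul, ← hβ, map_smul U.mkQ, h, ← map_smul, ← map_smul, ← map_smul]
      congr 2
      ext
      simp [mul_comm]
  | add a ha c hc h1 h2 =>
    obtain ⟨L1, h11, h12, h13⟩ := h1
    obtain ⟨L2, h21, h22, h23⟩ := h2
    have ha' : a ∈ m := mem_right_of_mem_mul ha
    have hc' : c ∈ m := mem_right_of_mem_mul hc
    refine ⟨L1 + L2, ?_, ?_, ?_⟩
    · intro φ h
      rw [LinearMap.add_apply, map_add, h11 φ ha', h21 φ hc', ← map_add]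
      rfl
    · intro φ n h
      rw [LinearMap.add_apply, h12 φ n h, h22 φ n h, add_smul]
    · intro φ r n h
      rw [LinearMap.add_apply, smul_add, h13 φ r n h, h23 φ r n h, add_smul]

/-- The subspace of pairs. -/
lemma key_equiv (m b : Ideal R) (U : Submodule R N) (hb : ∀ p ∈ b, ∀ n ∈ U, p • n = 0)
    (u : R) (hu : u ∈ b * m) (hU : ∀ n, u • n ∈ U → n ∈ U) :
    ∃ Φ : (↥(U ⊓ Submodule.torsionBySet R N (m : Set R)) × (m →ₗ[R] N ⧸ U)) →ₗ[R]
        (N ⧸ (Ideal.span {u} • ⊤ : Submodule R N)),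
      (∀ a, Φ a = 0 ↔ a.1 = 0 ∧ ∃ n : N, ∀ r : m, a.2 r = U.mkQ ((r : R) • n)) ∧
      LinearMap.range Φ = Submodule.torsionBySet R _ (m : Set R) := by
  obtain ⟨L, h1, h2, h3⟩ := exists_lift m b U hb u hu
  have hum : u ∈ m := mem_right_of_mem_mul hu
  have hub : u ∈ b := mem_left_of_mem_mul hu
  have hinj : ∀ a c : N ⧸ U, u • a = u • c → a = c := by
    intro a c h
    obtain ⟨a, rfl⟩ := U.mkQ_surjective a
    obtain ⟨c, rfl⟩ := U.mkQ_surjective c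
    rw [← map_smul, ← map_smul, ← sub_eq_zero, ← map_sub, ← smul_sub] at h
    rw [← sub_eq_zero, ← map_sub]
    simp only [Submodule.mkQ_apply, Submodule.Quotient.mk_eq_zero] at h ⊢
    exact hU _ h
  set V : Submodule R N := Ideal.span {u} • ⊤ with hV
  have memV : ∀ n, n ∈ V ↔ ∃ c, u • c = n := by
    intro n
    rw [hV, Submodule.ideal_span_singleton_smul, Submodule.mem_smul_pointwise_iff_exists]
    simp
  let Ψ : (↥(U ⊓ Submodule.torsionBySet R N (m : Set R)) × (m →ₗ[R] N ⧸ U)) →ₗ[R] N :=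
    LinearMap.coprod (Submodule.subtype _) L
  have hΨ : ∀ a, Ψ a = (a.1 : N) + L a.2 := fun a => by simp [Ψ]
  refine ⟨V.mkQ ∘ₗ Ψ, ?_, ?_⟩
  · rintro ⟨s, φ⟩
    rw [LinearMap.comp_apply, hΨ, Submodule.mkQ_apply, Submodule.Quotient.mk_eq_zero, memV]
    constructor
    · rintro ⟨n, hn⟩
      have e1 : φ ⟨u, hum⟩ = U.mkQ (u • n) := by
        rw [hn, map_add, h1 φ hum]
        have : U.mkQ (s : N) = 0 := by simpa using s.2.1
        simp only at this ⊢
        rw [this, zero_add]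
      have e2 : ∀ r : m, φ r = U.mkQ ((r : R) • n) := by
        intro r
        apply hinj
        rw [← map_smul, ← map_smul, smul_comm, map_smul U.mkQ, ← e1, ← map_smul]
        congr 1
        ext
        simp [mul_comm]
      refine ⟨?_, n, e2⟩
      have := h2 φ n e2
      simp only [this] at hn
      ext
      simpa using hn
    · rintro ⟨hs, n, hn⟩
      refine ⟨n, ?_⟩
      simp only at hs hn ⊢
      rw [h2 φ n hn, hs]
      simp
  · ext y
    obtain ⟨a, rfl⟩ := V.mkQ_surjective y
    rw [Submodule.mem_torsionBySet_iff]
    constructor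
    · rintro ⟨⟨s, φ⟩, h⟩ r
      rw [← h, LinearMap.comp_apply, hΨ, ← map_smul, Submodule.mkQ_apply,
        Submodule.Quotient.mk_eq_zero, memV, smul_add]
      obtain ⟨n, hn⟩ := U.mkQ_surjective (φ r)
      refine ⟨n, ?_⟩
      have := (Submodule.mem_torsionBySet_iff _ _).1 s.2.2 r
      simp only at this ⊢
      rw [this, zero_add, h3 φ r n hn]
    · intro h
      have h' : ∀ r : m, ∃ c, u • c = (r : R) • a := by
        intro r
        have := h r
        rwa [← map_smul, Submodule.mkQ_apply, Submodule.Quotient.mk_eq_zero, memV] at this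
      let f : N ⧸ U →ₗ[R] N ⧸ U := LinearMap.lsmul R _ u
      have hf : Function.Injective f := fun a c h => hinj a c h
      let g : m →ₗ[R] N ⧸ U := (LinearMap.toSpanSingleton R _ (U.mkQ a)).comp (Submodule.subtype m)
      have hg : ∀ r : m, g r = U.mkQ ((r : R) • a) := fun r => by simp [g]
      have hgf : ∀ r : m, g r ∈ LinearMap.range f := by
        intro r
        obtain ⟨c, hc⟩ := h' r
        exact ⟨U.mkQ c, by rw [hg, ← hc, map_smul]; rfl⟩
      let φ : m →ₗ[R] N ⧸ U := g.codRestrictOfInjective f hf hgf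
      have hφ : ∀ r, u • φ r = U.mkQ ((r : R) • a) := fun r => by
        rw [← hg]
        exact LinearMap.codRestrictOfInjective_comp_apply g f hf hgf r
      have e1 : φ ⟨u, hum⟩ = U.mkQ a := by
        apply hinj
        rw [hφ, map_smul]
      have e2 : a - L φ ∈ U := by
        rw [← Submodule.Quotient.mk_eq_zero, ← Submodule.mkQ_apply, map_sub, h1 φ hum, e1, sub_self]
      refine ⟨⟨⟨a - L φ, e2, ?_⟩, φ⟩, ?_⟩
      · change _ ∈ Submodule.torsionBySet R N (m : Set R)
        rw [Submodule.mem_torsionBySet_iff]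
        intro r
        obtain ⟨c, hc⟩ := h' r
        have : U.mkQ c = φ r := by
          apply hinj
          rw [hφ, ← hc, map_smul]
        have := h3 φ r c this
        rw [smul_sub]
        change (r : R) • a - (r : R) • L φ = 0
        rw [this, hc, sub_self]
      · rw [LinearMap.comp_apply, hΨ]
        simp

lemma key (m b : Ideal R) (u v : R) (hu : u ∈ b * m) (hv : v ∈ b * m)
    (huub : ∀ n : N, (u ^ 2) • n = 0 → ∀ p ∈ b, p • n = 0)
    (hvvb : ∀ n : N, (v ^ 2) • n = 0 → ∀ p ∈ b, p • n = 0) :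
    socDim R m (N ⧸ (Ideal.span {u} • ⊤ : Submodule R N)) =
      socDim R m (N ⧸ (Ideal.span {v} • ⊤ : Submodule R N)) := by
  let U : Submodule R N := Submodule.torsionBySet R N (b : Set R)
  have hU : ∀ n, n ∈ U ↔ ∀ p ∈ b, p • n = 0 := fun n => by
    simp [U, Submodule.mem_torsionBySet_iff]
  have hu' : u ∈ b := mem_left_of_mem_mul hu
  have hv' : v ∈ b := mem_left_of_mem_mul hv
  have hb : ∀ p ∈ b, ∀ n ∈ U, p • n = 0 := fun p hp n hn => (hU n).1 hn p hp
  obtain ⟨Φ, hΦ, hΦr⟩ := key_equiv m b U hb u hu (fun n hn => by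
    rw [hU]
    apply huub
    rw [pow_two, mul_smul]
    exact (hU _).1 hn u hu')
  obtain ⟨Φ', hΦ', hΦr'⟩ := key_equiv m b U hb v hv (fun n hn => by
    rw [hU]
    apply hvvb
    rw [pow_two, mul_smul]
    exact (hU _).1 hn v hv')
  have hk : LinearMap.ker Φ = LinearMap.ker Φ' := by
    ext a
    rw [LinearMap.mem_ker, LinearMap.mem_ker, hΦ, hΦ']
  apply socDim_eq_of_equiv
  exact (LinearEquiv.ofEq _ _ hΦr.symm).trans <| Φ.quotKerEquivRange.symm.trans <|
    (Submodule.quotEquivOfEq _ _ hk).trans <| Φ'.quotKerEquivRange.trans (LinearEquiv.ofEq _ _ hΦr')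

end Key

section Dim

variable {R : Type u} [CommRing R] [IsLocalRing R] [IsNoetherianRing R]

/-- `dim R/J ≤ n`. -/
def DimLe (J : Ideal R) (n : ℕ) : Prop := Module.supportDim R (R ⧸ J) ≤ n

lemma support_quot (J : Ideal R) :
    Module.support R (R ⧸ J) = PrimeSpectrum.zeroLocus (J : Set R) := by
  rw [Module.support_eq_zeroLocus, Ideal.annihilator_quotient]

lemma supportDim_congr {N N' : Type u} [AddCommGroup N] [Module R N] [AddCommGroup N']
    [Module R N'] (h : Module.support R N = Module.support R N') :
    Module.supportDim R N = Module.supportDim R N' := by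
  unfold Module.supportDim
  rw [h]

open scoped Pointwise in
lemma supportDim_sup (J : Ideal R) (z : R) :
    Module.supportDim R (QuotSMulTop z (R ⧸ J)) = Module.supportDim R (R ⧸ (J ⊔ Ideal.span {z})) := by
  apply supportDim_congr
  rw [Module.support_quotSMulTop, support_quot, support_quot, PrimeSpectrum.zeroLocus_sup,
    PrimeSpectrum.zeroLocus_span]

lemma dimLe_zero_of {J : Ideal R}
    (h : ∀ P : Ideal R, P.IsPrime → J ≤ P → P = maximalIdeal R) (n : ℕ) : DimLe J n := by
  have : Module.supportDim R (R ⧸ J) ≤ 0 := by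
    unfold Module.supportDim
    rw [Order.krullDim_nonpos_iff_forall_isMax]
    rintro ⟨P, hP⟩ ⟨Q, hQ⟩ hPQ
    rw [support_quot, PrimeSpectrum.mem_zeroLocus] at hP hQ
    have e1 := h P.asIdeal P.2 hP
    have e2 := h Q.asIdeal Q.2 hQ
    change Q.asIdeal ≤ P.asIdeal
    rw [e1, e2]
  unfold DimLe
  exact this.trans (by exact_mod_cast Nat.zero_le n)

lemma DimLe.eq_max {J : Ideal R} (h : DimLe J 0) (P : Ideal R) (hP : P.IsPrime) (hJ : J ≤ P) :
    P = maximalIdeal R := by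
  unfold DimLe Module.supportDim at h
  rw [Nat.cast_zero, Order.krullDim_nonpos_iff_forall_isMax] at h
  have h1 : (⟨P, hP⟩ : PrimeSpectrum R) ∈ Module.support R (R ⧸ J) := by
    rw [support_quot]; exact hJ
  have hle := IsLocalRing.le_maximalIdeal hP.ne_top
  have h2 : (⟨maximalIdeal R, inferInstance⟩ : PrimeSpectrum R) ∈ Module.support R (R ⧸ J) := by
    rw [support_quot]; exact hJ.trans hle
  exact le_antisymm hle (h ⟨_, h1⟩ (b := ⟨_, h2⟩) hle)

lemma DimLe.up {J : Ideal R} {z : R} (hz : z ∈ maximalIdeal R) {n : ℕ}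
    (h : DimLe (J ⊔ Ideal.span {z}) n) : DimLe J (n + 1) := by
  unfold DimLe at *
  refine (Module.supportDim_le_supportDim_quotSMulTop_succ (M := R ⧸ J) hz).trans ?_
  rw [supportDim_sup, Nat.cast_add, Nat.cast_one]
  gcongr

lemma DimLe.down {J : Ideal R} {z : R} {n : ℕ} (h : DimLe J (n + 1))
    (hz : ∀ P ∈ J.minimalPrimes, P ≠ maximalIdeal R → z ∉ P) :
    DimLe (J ⊔ Ideal.span {z}) n := by
  by_cases hm : maximalIdeal R ∈ J.minimalPrimes
  · apply dimLe_zero_of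
    intro P hP hJ
    have hle := IsLocalRing.le_maximalIdeal hP.ne_top
    exact le_antisymm hle (hm.2 ⟨hP, le_sup_left.trans hJ⟩ hle)
  · have := Module.supportDim_quotSMulTop_succ_le_of_notMem_minimalPrimes (M := R ⧸ J) (x := z)
      (by
        rw [Ideal.annihilator_quotient]
        intro P hP
        exact hz P hP (fun e => hm (e ▸ hP)))
    unfold DimLe at *
    rw [supportDim_sup] at this
    have := this.trans h
    rw [Nat.cast_add, Nat.cast_one] at this
    generalize Module.supportDim R (R ⧸ J ⊔ Ideal.span {z}) = t at *
    induction t with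
    | bot => simp
    | coe t =>
      induction t with
      | top => exact absurd this (by
          intro h
          have h' : (((⊤ : ℕ∞) + 1 : ℕ∞) : WithBot ℕ∞) ≤ ((n + 1 : ℕ) : ℕ∞) := by exact_mod_cast h
          rw [WithBot.coe_le_coe] at h'
          simp at h')
      | coe t =>
        have h' : t + 1 ≤ n + 1 := by exact_mod_cast this
        exact_mod_cast Nat.le_of_succ_le_succ h'

lemma exists_z (d : ℕ) (A B : Bool → ℕ → Ideal R) (hA : ∀ ε, ∀ j ≤ d, DimLe (A ε j) j)
    (hAB : ∀ ε, ∀ j < d, A ε j ≤ B ε j) :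
    ∃ z : ℕ → R, (∀ i < d, z i ∈ (B true i * B false i) * maximalIdeal R) ∧
      ∀ ε, ∀ j ≤ d, DimLe (A ε j ⊔ Ideal.span (z '' Set.Iio j)) 0 := by
  suffices H : ∀ n ≤ d, ∃ z : ℕ → R,
      (∀ i < n, z i ∈ (B true i * B false i) * maximalIdeal R) ∧
      ∀ ε, ∀ j ≤ d, DimLe (A ε j ⊔ Ideal.span (z '' Set.Iio (min n j))) (j - n) by
    obtain ⟨z, h1, h2⟩ := H d le_rfl
    refine ⟨z, h1, fun ε j hj => ?_⟩
    have := h2 ε j hj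
    rwa [min_eq_right hj, Nat.sub_eq_zero_of_le hj] at this
  intro n
  induction n with
  | zero =>
    intro _
    refine ⟨0, by simp, fun ε j hj => ?_⟩
    simpa using hA ε j hj
  | succ n ih =>
    intro hn
    obtain ⟨z, h1, h2⟩ := ih (by omega)
    let S : Set (Ideal R) := (⋃ ε : Bool, ⋃ j ∈ Set.Iic d,
      (A ε j ⊔ Ideal.span (z '' Set.Iio n)).minimalPrimes) \ {maximalIdeal R}
    have hS : S.Finite := by
      refine Set.Finite.sdiff ?_
      refine Set.finite_iUnion fun ε => (Set.finite_Iic d).biUnion fun j _ => ?_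
      exact Ideal.finite_minimalPrimes_of_isNoetherianRing R _
    have hSp : ∀ P ∈ S, P.IsPrime ∧ P ≠ maximalIdeal R ∧ Ideal.span (z '' Set.Iio n) ≤ P := by
      rintro P ⟨hP, hPm⟩
      simp only [Set.mem_iUnion] at hP
      obtain ⟨ε, j, _, hP⟩ := hP
      exact ⟨hP.1.1, hPm, le_sup_right.trans hP.1.2⟩
    have hB : ∀ ε, ∀ P ∈ S, ¬ B ε n ≤ P := by
      intro ε P hP hB
      obtain ⟨h3, h4, h5⟩ := hSp P hP
      have h6 := h2 ε n (by omega)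
      rw [min_self, Nat.sub_self] at h6
      exact h4 (h6.eq_max P h3 (sup_le ((hAB ε n (by omega)).trans hB) h5))
    have : ¬ (((B true n * B false n) * maximalIdeal R : Ideal R) : Set R) ⊆ ⋃ P ∈ S, (id P : Ideal R) := by
      intro hsub
      obtain ⟨P, hP, hle⟩ := (Ideal.subset_union_prime_finite hS (f := id) ⊥ ⊥
        (fun P hP _ _ => (hSp P hP).1)).1 hsub
      simp only [id] at hle
      obtain ⟨h3, h4, h5⟩ := hSp P hP
      rcases h3.mul_le.1 hle with hle | hle
      · rcases h3.mul_le.1 hle with hle | hle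
        · exact hB _ P hP hle
        · exact hB _ P hP hle
      · exact h4 (le_antisymm (IsLocalRing.le_maximalIdeal h3.ne_top) hle)
    rw [Set.not_subset] at this
    obtain ⟨w, hw, hw'⟩ := this
    have hwS : ∀ P ∈ S, w ∉ P := fun P hP h => hw' (Set.mem_biUnion hP h)
    have himg : ∀ k ≤ n, (Function.update z n w) '' Set.Iio k = z '' Set.Iio k := by
      intro k hk
      apply Set.image_congr
      intro a ha
      rw [Function.update_of_ne]
      simp only [Set.mem_Iio] at ha
      omega
    refine ⟨Function.update z n w, ?_, ?_⟩
    · intro i hi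
      by_cases hin : i = n
      · subst hin
        simpa using hw
      · rw [Function.update_of_ne hin]
        exact h1 i (by omega)
    · intro ε j hj
      have h6 := h2 ε j hj
      by_cases hjn : j ≤ n
      · rw [min_eq_right hjn, Nat.sub_eq_zero_of_le hjn] at h6
        rw [min_eq_right (by omega), Nat.sub_eq_zero_of_le (by omega), himg j hjn]
        exact h6
      · rw [min_eq_left (by omega)] at h6 ⊢
        have e : (Function.update z n w) '' Set.Iio (n + 1) = (z '' Set.Iio n) ∪ {w} := by
          have : Set.Iio (n + 1) = insert n (Set.Iio n) := by
            ext a; simp only [Set.mem_Iio, Set.mem_insert_iff]; omega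
          rw [this, Set.image_insert_eq, himg n le_rfl, Function.update_self,
            Set.union_singleton]
        rw [e, Ideal.span_union, ← sup_assoc]
        apply DimLe.down
        · convert h6 using 1
          omega
        · intro P hP hPm
          apply hwS
          refine ⟨?_, hPm⟩
          simp only [Set.mem_iUnion]
          exact ⟨ε, j, hj, hP⟩

lemma isFiniteLength_iff {N : Type u} [AddCommGroup N] [Module R N] [Module.Finite R N] :
    IsFiniteLength R N ↔ ∀ P ∈ Module.support R N, P.asIdeal = maximalIdeal R := by
  constructor
  · intro h P hP
    obtain ⟨_, _⟩ := isFiniteLength_iff_isNoetherian_isArtinian.1 h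
    have hP' : Module.annihilator R N ≤ P.asIdeal := by
      rw [Module.support_eq_zeroLocus] at hP
      exact hP
    obtain ⟨n, hn⟩ := IsArtinian.monotone_stabilizes (R := R) (M := N)
      ⟨fun k => OrderDual.toDual ((maximalIdeal R) ^ k • (⊤ : Submodule R N)), fun a b hab =>
        Submodule.smul_mono_left (Ideal.pow_le_pow_right hab)⟩
    have hn1 : (maximalIdeal R) ^ n • (⊤ : Submodule R N) =
      (maximalIdeal R) ^ (n+1) • (⊤ : Submodule R N) := hn (n + 1) (by omega)
    have hn2 : (maximalIdeal R) ^ n • (⊤ : Submodule R N) = ⊥ := by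
      apply Submodule.eq_bot_of_le_smul_of_le_jacobson_bot (maximalIdeal R) _
        (IsNoetherian.noetherian _)
      · rw [← mul_smul, ← pow_succ']
        exact hn1.le
      · exact IsLocalRing.maximalIdeal_le_jacobson _
    have hn3 : (maximalIdeal R) ^ n ≤ P.asIdeal := by
      refine le_trans ?_ hP'
      rw [← Submodule.annihilator_top, Submodule.le_annihilator_iff]
      exact hn2
    exact le_antisymm (IsLocalRing.le_maximalIdeal P.2.ne_top) (P.2.le_of_pow_le hn3)
  · intro h
    rw [isFiniteLength_iff_isNoetherian_isArtinian]
    refine ⟨inferInstance, ?_⟩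
    let I := Module.annihilator R N
    have hI : IsArtinianRing (R ⧸ I) := by
      rw [isArtinianRing_iff_isNoetherianRing_krullDimLE_zero]
      refine ⟨inferInstance, ?_⟩
      rw [Ring.krullDimLE_zero_iff]
      intro Q hQ
      have hc : (Q.comap (Ideal.Quotient.mk I)).IsPrime := inferInstance
      have h1 := h ⟨_, hc⟩ (by
        rw [Module.support_eq_zeroLocus]
        change I ≤ _
        intro a ha
        rw [Ideal.mem_comap, Ideal.Quotient.eq_zero_iff_mem.2 ha]
        exact Q.zero_mem)
      have : (Q.comap (Ideal.Quotient.mk I)).IsMaximal := by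
        simp only at h1
        rw [h1]; infer_instance
      rw [← Ideal.map_comap_of_surjective _ Ideal.Quotient.mk_surjective Q]
      refine (Ideal.map_eq_top_or_isMaximal_of_surjective _ Ideal.Quotient.mk_surjective
        this).resolve_left ?_
      rw [Ideal.map_comap_of_surjective _ Ideal.Quotient.mk_surjective Q]
      exact hQ.ne_top
    letI : Module (R ⧸ I) N := Module.quotientAnnihilator
    haveI : IsScalarTower R (R ⧸ I) N := ⟨fun r s n => by
      obtain ⟨s, rfl⟩ := Ideal.Quotient.mk_surjective s
      change (r • s) • n = r • (s • n)
      rw [smul_assoc]⟩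
    haveI : Module.Finite (R ⧸ I) N := Module.Finite.of_restrictScalars_finite R _ _
    exact isArtinian_of_surjective_algebraMap (R := R ⧸ I) (S := R) (M := N)
        Ideal.Quotient.mk_surjective

end Dim

section Final

variable {R : Type u} [CommRing R] [IsLocalRing R]
variable {M : Type u} [AddCommGroup M] [Module R M]

lemma mem_bIdeal_of_kill {r : R} (h : ∀ a : M, r • a = 0) (n : ℕ) : r ∈ bIdeal R M n := by
  unfold bIdeal
  simp only [Submodule.mem_iInf, Module.mem_annihilator]
  rintro x _ i ⟨a, ha⟩
  obtain ⟨a, rfl⟩ := Submodule.Quotient.mk_surjective _ a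
  ext
  change r • (Submodule.Quotient.mk a : M ⧸ (Ideal.span (x '' {j | j < i}) • ⊤ : Submodule R M)) = 0
  rw [← Submodule.Quotient.mk_smul, h, Submodule.Quotient.mk_zero]

lemma mk_mem_smul_top_iff (I J : Ideal R) (a : M) :
    (Submodule.Quotient.mk a : M ⧸ (J • ⊤ : Submodule R M)) ∈
      (I • ⊤ : Submodule R (M ⧸ (J • ⊤ : Submodule R M))) ↔ a ∈ ((I ⊔ J) • ⊤ : Submodule R M) := by
  have h : (I • ⊤ : Submodule R (M ⧸ (J • ⊤ : Submodule R M))) =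
      (I • ⊤ : Submodule R M).map (J • ⊤ : Submodule R M).mkQ := by
    rw [Submodule.map_smul'', Submodule.map_top, Submodule.range_mkQ]
  rw [h, ← Submodule.mkQ_apply, ← Submodule.mem_comap, Submodule.comap_map_eq, Submodule.ker_mkQ,
    Submodule.sup_smul]

/-- `M/(I ⊔ J)M` is `(M/JM)/I(M/JM)`. -/
noncomputable def quotSupEquiv (I J : Ideal R) :
    (M ⧸ ((I ⊔ J) • ⊤ : Submodule R M)) ≃ₗ[R]
      ((M ⧸ (J • ⊤ : Submodule R M)) ⧸ (I • ⊤ : Submodule R (M ⧸ (J • ⊤ : Submodule R M)))) :=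
  (Submodule.quotEquivOfEq _ _ (by
    ext a
    rw [LinearMap.mem_ker, LinearMap.comp_apply, Submodule.mkQ_apply, Submodule.mkQ_apply,
      Submodule.Quotient.mk_eq_zero, mk_mem_smul_top_iff])).trans
  (LinearMap.quotKerEquivOfSurjective
    ((I • ⊤ : Submodule R (M ⧸ (J • ⊤ : Submodule R M))).mkQ ∘ₗ (J • ⊤ : Submodule R M).mkQ)
    ((Submodule.mkQ_surjective _).comp (Submodule.mkQ_surjective _)))

variable [IsNoetherianRing R] [Module.Finite R M]

lemma torsion_kill {J : Ideal R} {i : ℕ} {z : ℕ → R} {w p : R}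
    (hz : ∀ k < i, z k ∈ maximalIdeal R) (hw : w ∈ maximalIdeal R)
    (hfl : ∀ P : Ideal R, P.IsPrime → Module.annihilator R M ≤ P → Ideal.span (z '' Set.Iio i) ≤ P →
      J ≤ P → w ∈ P → P = maximalIdeal R)
    (hp : p ∈ bIdeal R (M ⧸ (J • ⊤ : Submodule R M)) (i + 1)) (a : M)
    (ha : w • a ∈ ((Ideal.span (z '' Set.Iio i) ⊔ J) • ⊤ : Submodule R M)) :
    p • a ∈ ((Ideal.span (z '' Set.Iio i) ⊔ J) • ⊤ : Submodule R M) := by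
  let s : Fin (i + 1) → R := fun k => if k.val < i then z k else w
  have hs0 : s (Fin.last i) = w := by simp [s]
  have hs1 : s '' {j | j < Fin.last i} = z '' Set.Iio i := by
    ext r
    simp only [Set.mem_image, Set.mem_setOf_eq, Set.mem_Iio]
    constructor
    · rintro ⟨k, hk, rfl⟩
      have hk' : k.val < i := hk
      exact ⟨k, hk', by simp [s, hk']⟩
    · rintro ⟨k, hk, rfl⟩
      exact ⟨⟨k, by omega⟩, hk, by simp [s, hk]⟩
  have hsm : ∀ k, s k ∈ maximalIdeal R := by
    intro k
    simp only [s]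
    split_ifs with h
    · exact hz _ h
    · exact hw
  have hsop : IsSOP R (M ⧸ (J • ⊤ : Submodule R M)) (i + 1) s := by
    refine ⟨hsm, ?_⟩
    rw [isFiniteLength_iff]
    intro P hP
    rw [Module.support_quotient, Module.support_quotient, Module.support_eq_zeroLocus] at hP
    obtain ⟨⟨h1, h2⟩, h3⟩ := hP
    have h3' : ∀ k, s k ∈ P.asIdeal := fun k => h3 (Ideal.subset_span ⟨k, rfl⟩)
    refine hfl P.asIdeal P.2 h1 ?_ h2 (hs0 ▸ h3' _)
    rw [← hs1, Ideal.span_le]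
    rintro _ ⟨k, _, rfl⟩
    exact h3' k
  unfold bIdeal at hp
  simp only [Submodule.mem_iInf, Module.mem_annihilator] at hp
  have hp := hp s hsop (Fin.last i)
  rw [hs1, hs0] at hp
  have key : ∀ r : R, ∀ a : M, r • (Submodule.Quotient.mk (Submodule.Quotient.mk a) :
      (M ⧸ (J • ⊤ : Submodule R M)) ⧸ (Ideal.span (z '' Set.Iio i) • ⊤ :
        Submodule R (M ⧸ (J • ⊤ : Submodule R M)))) = 0 ↔
      r • a ∈ ((Ideal.span (z '' Set.Iio i) ⊔ J) • ⊤ : Submodule R M) := by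
    intro r a
    rw [← Submodule.Quotient.mk_smul, ← Submodule.Quotient.mk_smul, Submodule.Quotient.mk_eq_zero,
      mk_mem_smul_top_iff]
  have := hp ⟨Submodule.Quotient.mk (Submodule.Quotient.mk a), by
    rw [Submodule.mem_torsionBy_iff]; exact (key w a).2 ha⟩
  rw [← key]
  exact congrArg Subtype.val this

lemma step {J : Ideal R} {i : ℕ} {z : ℕ → R} {u v : R}
    (hz : ∀ k < i, z k ∈ maximalIdeal R)
    (hu : u ∈ bIdeal R (M ⧸ (J • ⊤ : Submodule R M)) (i + 1) * maximalIdeal R)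
    (hv : v ∈ bIdeal R (M ⧸ (J • ⊤ : Submodule R M)) (i + 1) * maximalIdeal R)
    (hfu : ∀ P : Ideal R, P.IsPrime → Module.annihilator R M ≤ P → Ideal.span (z '' Set.Iio i) ≤ P →
      J ≤ P → u ∈ P → P = maximalIdeal R)
    (hfv : ∀ P : Ideal R, P.IsPrime → Module.annihilator R M ≤ P → Ideal.span (z '' Set.Iio i) ≤ P →
      J ≤ P → v ∈ P → P = maximalIdeal R) :
    ir R M (Ideal.span {u} ⊔ (Ideal.span (z '' Set.Iio i) ⊔ J)) =
      ir R M (Ideal.span {v} ⊔ (Ideal.span (z '' Set.Iio i) ⊔ J)) := by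
  unfold ir
  rw [socDim_congr _ (quotSupEquiv (M := M) (Ideal.span {u}) (Ideal.span (z '' Set.Iio i) ⊔ J)),
    socDim_congr _ (quotSupEquiv (M := M) (Ideal.span {v}) (Ideal.span (z '' Set.Iio i) ⊔ J))]
  have aux : ∀ w : R, w ∈ bIdeal R (M ⧸ (J • ⊤ : Submodule R M)) (i + 1) * maximalIdeal R →
      (∀ P : Ideal R, P.IsPrime → Module.annihilator R M ≤ P → Ideal.span (z '' Set.Iio i) ≤ P →
      J ≤ P → w ∈ P → P = maximalIdeal R) →
      ∀ n : M ⧸ ((Ideal.span (z '' Set.Iio i) ⊔ J) • ⊤ : Submodule R M), (w ^ 2) • n = 0 →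
        ∀ p ∈ bIdeal R (M ⧸ (J • ⊤ : Submodule R M)) (i + 1), p • n = 0 := by
    intro w hw hfw n hn p hp
    obtain ⟨a, rfl⟩ := Submodule.Quotient.mk_surjective _ n
    rw [← Submodule.Quotient.mk_smul, Submodule.Quotient.mk_eq_zero] at hn ⊢
    refine torsion_kill hz (Ideal.pow_mem_of_mem _ (mem_right_of_mem_mul hw) 2 (by norm_num))
      ?_ hp a hn
    intro P hP h1 h2 h3 h4
    exact hfw P hP h1 h2 h3 (hP.mem_of_pow_mem _ h4)
  exact key (maximalIdeal R) _ u v hu hv (aux u hu hfu) (aux v hv hfv)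

/-- The ideals `Ann M + (x_n, ..., x_d)`. -/
def AId (M : Type u) [AddCommGroup M] [Module R M] {d : ℕ} (x : Fin d → R) (n : ℕ) : Ideal R :=
  Module.annihilator R M ⊔ Ideal.span (x '' {j | n ≤ j.val})

/-- The ideals `b(M/(x_{n+1}, ..., x_d)M)`. -/
noncomputable def BId (M : Type u) [AddCommGroup M] [Module R M] {d : ℕ} (x : Fin d → R) (n : ℕ) :
    Ideal R :=
  bIdeal R (M ⧸ (Ideal.span (x '' {j | n < j.val}) • ⊤ : Submodule R M)) (n + 1)

lemma AId_dim {d : ℕ} {x : Fin d → R} (hx : IsSOP R M d x) : ∀ j ≤ d, DimLe (AId M x j) j := by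
  intro j
  induction j with
  | zero =>
    intro _
    apply dimLe_zero_of
    intro P hP hle
    have := isFiniteLength_iff.1 hx.2 ⟨P, hP⟩
    apply this
    rw [Module.support_quotient, Module.support_eq_zeroLocus]
    refine ⟨le_sup_left.trans hle, ?_⟩
    have : Ideal.span (Set.range x) ≤ P := by
      refine le_trans ?_ (le_sup_right.trans hle)
      simp
    exact this
  | succ j ih =>
    intro hj
    apply DimLe.up (hx.1 ⟨j, by omega⟩)
    convert ih (by omega) using 1
    unfold AId
    rw [sup_assoc, ← Ideal.span_union]
    congr 2
    ext r
    simp only [Set.mem_union, Set.mem_image, Set.mem_setOf_eq, Set.mem_singleton_iff]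
    constructor
    · rintro (⟨k, hk, rfl⟩ | rfl)
      · exact ⟨k, by omega, rfl⟩
      · exact ⟨⟨j, by omega⟩, le_rfl, rfl⟩
    · rintro ⟨k, hk, rfl⟩
      by_cases h : k.val = j
      · right
        congr 1
        ext
        exact h
      · exact Or.inl ⟨k, by omega, rfl⟩

lemma mem_BId {d : ℕ} {x : Fin d → R} (hx : IsCSOP R M d x) (i : Fin d) :
    x i ∈ BId M x i.val ^ 3 := hx.2 i

lemma AId_le_BId {d : ℕ} {x : Fin d → R} (hx : IsCSOP R M d x) : ∀ j < d, AId M x j ≤ BId M x j := by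
  intro j hj
  refine sup_le ?_ ?_
  · intro r hr
    apply mem_bIdeal_of_kill
    intro a
    obtain ⟨a, rfl⟩ := Submodule.Quotient.mk_surjective _ a
    rw [← Submodule.Quotient.mk_smul, Module.mem_annihilator.1 hr a, Submodule.Quotient.mk_zero]
  · rw [Ideal.span_le]
    rintro _ ⟨k, hk, rfl⟩
    by_cases h : k.val = j
    · subst h
      exact Ideal.pow_le_self (by norm_num) (mem_BId hx k)
    · apply mem_bIdeal_of_kill
      intro a
      obtain ⟨a, rfl⟩ := Submodule.Quotient.mk_surjective _ a
      rw [← Submodule.Quotient.mk_smul, Submodule.Quotient.mk_eq_zero]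
      refine Submodule.smul_mem_smul (Ideal.subset_span ⟨k, ?_, rfl⟩) Submodule.mem_top
      have hk' : j ≤ k.val := hk
      change j < k.val
      omega

lemma chain {d : ℕ} {x : Fin d → R} (hx : IsCSOP R M d x) {z : ℕ → R}
    (hz : ∀ i < d, z i ∈ BId M x i * maximalIdeal R)
    (hdim : ∀ j ≤ d, DimLe (AId M x j ⊔ Ideal.span (z '' Set.Iio j)) 0) :
    ir R M (Ideal.span (Set.range x)) = ir R M (Ideal.span (z '' Set.Iio d)) := by
  have H : ∀ n ≤ d, ir R M (Ideal.span (Set.range x)) =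
      ir R M (Ideal.span (z '' Set.Iio n) ⊔ Ideal.span (x '' {j | n ≤ j.val})) := by
    intro n
    induction n with
    | zero =>
      intro _
      congr 1
      simp
    | succ n ih =>
      intro hn
      rw [ih (by omega)]
      have hnd : n < d := by omega
      have e1 : Ideal.span (x '' {j | n ≤ j.val}) =
          Ideal.span {x ⟨n, hnd⟩} ⊔ Ideal.span (x '' {j | n < j.val}) := by
        rw [← Ideal.span_union]
        congr 1
        ext r
        simp only [Set.mem_union, Set.mem_image, Set.mem_setOf_eq, Set.mem_singleton_iff]
        constructor
        · rintro ⟨k, hk, rfl⟩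
          by_cases h : k.val = n
          · left
            congr 1
            ext
            exact h
          · exact Or.inr ⟨k, by omega, rfl⟩
        · rintro (rfl | ⟨k, hk, rfl⟩)
          · exact ⟨⟨n, hnd⟩, le_rfl, rfl⟩
          · exact ⟨k, by omega, rfl⟩
      have e2 : Ideal.span (z '' Set.Iio (n + 1)) =
          Ideal.span {z n} ⊔ Ideal.span (z '' Set.Iio n) := by
        have : Set.Iio (n + 1) = insert n (Set.Iio n) := by
          ext a; simp only [Set.mem_Iio, Set.mem_insert_iff]; omega
        rw [this, Set.image_insert_eq, Ideal.span_insert]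
      have e3 : {j : Fin d | n + 1 ≤ j.val} = {j : Fin d | n < j.val} := rfl
      have d1 := hdim n (by omega)
      have d2 := hdim (n + 1) hn
      unfold AId at d1 d2
      rw [e1] at d1
      rw [e2, e3] at d2
      rw [e1, e2, e3, sup_left_comm, sup_assoc]
      apply step
      · intro k hk
        exact mem_right_of_mem_mul (hz k (by omega))
      · have h1 : x ⟨n, hnd⟩ ∈ BId M x n ^ 3 := mem_BId hx ⟨n, hnd⟩
        change x ⟨n, hnd⟩ ∈ BId M x n * maximalIdeal R
        by_cases hb : BId M x n = ⊤
        · rw [hb, Ideal.top_mul]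
          exact hx.1.1 _
        · have hle : BId M x n ^ 3 ≤ BId M x n * maximalIdeal R := by
            calc BId M x n ^ 3 ≤ BId M x n ^ 2 := Ideal.pow_le_pow_right (by norm_num)
              _ = BId M x n * BId M x n := pow_two _
              _ ≤ _ := Ideal.mul_mono_right (IsLocalRing.le_maximalIdeal hb)
          exact hle h1
      · exact hz n hnd
      · intro P hP h1 h2 h3 h4
        refine d1.eq_max P hP (sup_le (sup_le h1 (sup_le ?_ h3)) h2)
        rwa [Ideal.span_singleton_le_iff_mem]
      · intro P hP h1 h2 h3 h4
        refine d2.eq_max P hP (sup_le (sup_le h1 h3) (sup_le ?_ h2))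
        rwa [Ideal.span_singleton_le_iff_mem]
  rw [H d le_rfl]
  congr 1
  have : {j : Fin d | d ≤ j.val} = ∅ := by
    ext j
    simp
  rw [this]
  simp

end Final

end Paper

/-- The index of reducibility of the ideal generated by a C-system of
parameters of `M` is independent of the choice of the C-system of parameters. -/
theorem stmt0 (R : Type u) [CommRing R] [IsLocalRing R] [IsNoetherianRing R]
    (hCM : IsQuotientOfCMLocalRing R)
    (M : Type u) [AddCommGroup M] [Module R M] [Module.Finite R M]
    (d : ℕ) (hd : 0 < d) (hdim : mdim R M = d)
    (x y : Fin d → R) (hx : IsCSOP R M d x) (hy : IsCSOP R M d y) :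
    ir R M (Ideal.span (Set.range x)) = ir R M (Ideal.span (Set.range y)) := by
  obtain ⟨z, hz, hzd⟩ := exists_z d
    (fun ε => if ε then AId M x else AId M y) (fun ε => if ε then BId M x else BId M y)
    (by
      intro ε
      cases ε
      · simpa using AId_dim hy.1
      · simpa using AId_dim hx.1)
    (by
      intro ε
      cases ε
      · simpa using AId_le_BId hy
      · simpa using AId_le_BId hx)
  simp only [Bool.false_eq_true, if_true, if_false] at hz
  rw [chain hx (z := z), chain hy (z := z)]
  · intro i hi
    exact Ideal.mul_mono_left (fun _ h => mem_right_of_mem_mul h) (hz i hi)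
  · simpa using hzd false
  · intro i hi
    exact Ideal.mul_mono_left (fun _ h => mem_left_of_mem_mul h) (hz i hi)
  · simpa using hzd true
end

section
/- M is Cohen-Macaulay if and only if N_R(M) = dim_k Soc(H^d_m(M)). -/
open IsLocalRing

universe u

namespace Paper

variable (R : Type u) [CommRing R]

/-- `dim_k Soc (H^i_m(M))`. -/
noncomputable def socH [IsLocalRing R] (M : Type u) [AddCommGroup M] [Module R M] (i : ℕ) : ℕ :=
  socDim R (maximalIdeal R) ((localCohomology (maximalIdeal R) i).obj (ModuleCat.of R M))

/-- A parameter element: an element occurring in some system of parameters of `M`. -/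
def IsParamElement [IsLocalRing R] (M : Type u) [AddCommGroup M] [Module R M] (d : ℕ)
    (a : R) : Prop :=
  ∃ x : Fin d → R, IsSOP R M d x ∧ ∃ i, x i = a

/-- The largest submodule of (the submodule) `N` whose dimension is strictly smaller than
that of `N`. -/
noncomputable def uComp (M : Type u) [AddCommGroup M] [Module R M] (N : Submodule R M) :
    Submodule R M :=
  sSup {P : Submodule R M | P ≤ N ∧ mdim R P < mdim R N}

/-- The unmixed component `U_M(0)` of `M`: the largest submodule of dimension `< dim M`. -/
noncomputable def unmixedComp (M : Type u) [AddCommGroup M] [Module R M] : Submodule R M :=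
  uComp R M ⊤

/-- The 0-th local cohomology `H^0_m(M)` realized as the submodule of elements annihilated by
some power of the maximal ideal. -/
def H0sub [IsLocalRing R] (M : Type u) [AddCommGroup M] [Module R M] : Submodule R M :=
  ⨆ n : ℕ, Submodule.torsionBySet R M (((maximalIdeal R) ^ n : Ideal R) : Set R)

/-- The quotient `P/N` of two submodules of `M`. -/
abbrev subQuot (M : Type u) [AddCommGroup M] [Module R M] (P N : Submodule R M) :=
  P ⧸ (Submodule.comap P.subtype N)

/-- `D_0 ⊆ D_1 ⊆ ⋯ ⊆ D_t = M` is the dimension filtration of `M`: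
`D_t = M`, each `D_{i-1}` is the largest submodule of `D_i` of strictly smaller dimension,
and `D_0 = H^0_m(M)`. -/
def IsDimFiltration [IsLocalRing R] (M : Type u) [AddCommGroup M] [Module R M]
    (t : ℕ) (D : Fin (t + 1) → Submodule R M) : Prop :=
  D (Fin.last t) = ⊤ ∧ (∀ i : Fin t, D i.castSucc = uComp R M (D i.succ)) ∧
    D 0 = H0sub R M

/-- `M` is sequentially Cohen-Macaulay: all quotients `D_i/D_{i-1}` of the dimension
filtration are Cohen-Macaulay. -/
def IsSeqCM [IsLocalRing R] (M : Type u) [AddCommGroup M] [Module R M] : Prop :=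
  ∃ (t : ℕ) (D : Fin (t + 1) → Submodule R M), IsDimFiltration R M t D ∧
    ∀ i : Fin t, IsCM R (subQuot R M (D i.succ) (D i.castSucc))

/-- `M` (of dimension `d`) is generalized Cohen-Macaulay: `H^i_m(M)` has finite length
for all `i < d`. -/
def IsGenCM [IsLocalRing R] (M : Type u) [AddCommGroup M] [Module R M] (d : ℕ) : Prop :=
  ∀ i < d, IsFiniteLength R ((localCohomology (maximalIdeal R) i).obj (ModuleCat.of R M))

/-- `α_n(M)`: the minimum of the indices of reducibility of parameter ideals of `M`
contained in `m^n`. -/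
noncomputable def alphaN [IsLocalRing R] (M : Type u) [AddCommGroup M] [Module R M]
    (d n : ℕ) : ℕ :=
  sInf {r : ℕ | ∃ x : Fin d → R, IsSOP R M d x ∧
    Ideal.span (Set.range x) ≤ (maximalIdeal R) ^ n ∧ r = ir R M (Ideal.span (Set.range x))}

/-- The limit value `α(M) = lim_n α_n(M)` (the supremum of the non-decreasing sequence). -/
noncomputable def alphaLim [IsLocalRing R] (M : Type u) [AddCommGroup M] [Module R M]
    (d : ℕ) : ℕ :=
  ⨆ n : ℕ, alphaN R M d (n + 1)

/-- `M` is unmixed: `dim R/p = dim M` for all associated primes `p`. -/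
def IsUnmixed (M : Type u) [AddCommGroup M] [Module R M] : Prop :=
  ∀ p ∈ associatedPrimes R M, ringKrullDim (R ⧸ p) = mdim R M

/-- Serre's condition `(S_2)` for a module. -/
def IsS2 (L : Type u) [AddCommGroup L] [Module R L] : Prop :=
  ∀ p : PrimeSpectrum R, p ∈ Module.support R L →
    min 2 (mdim (Localization.AtPrime p.asIdeal) (LocalizedModule p.asIdeal.primeCompl L)) ≤
      (depth (Localization.AtPrime p.asIdeal) (LocalizedModule p.asIdeal.primeCompl L) :
        WithBot (WithTop ℕ))

/-- `ι : M →ₗ[R] S` exhibits `S` as an `S_2`-ification of `M`. -/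
def IsS2ification [IsLocalRing R] (M S : Type u) [AddCommGroup M] [Module R M]
    [AddCommGroup S] [Module R S] (ι : M →ₗ[R] S) : Prop :=
  Function.Injective ι ∧ Module.Finite R S ∧ IsS2 R S ∧
    ∀ (p : Ideal R) [p.IsPrime], p ≠ maximalIdeal R →
      IsS2 (Localization.AtPrime p) (LocalizedModule p.primeCompl M) →
      Function.Surjective (IsLocalizedModule.map p.primeCompl
        (LocalizedModule.mkLinearMap p.primeCompl M)
        (LocalizedModule.mkLinearMap p.primeCompl S) ι)

end Paper

open Paper IsLocalRing

namespace LC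
open CategoryTheory CategoryTheory.Abelian

variable {R : Type u} [CommRing R] (I : Ideal R)

/-- the module `R / I^n` as an object. -/
noncomputable abbrev T (n : ℕ) : ModuleCat.{u} R := ModuleCat.of R (R ⧸ I ^ n)

/-- transition maps -/
noncomputable def tr (m n : ℕ) (h : m ≤ n) : T I n ⟶ T I m :=
  ModuleCat.ofHom (Submodule.mapQ _ _ LinearMap.id (Ideal.pow_le_pow_right h))

lemma tr_self (m : ℕ) : tr I m m le_rfl = 𝟙 _ := by
  ext; rfl

lemma tr_comp (l m n : ℕ) (h : l ≤ m) (h' : m ≤ n) :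
    tr I m n h' ≫ tr I l m h = tr I l n (h.trans h') := by
  ext; rfl

/-- the transition maps on Ext. -/
noncomputable def fE (M : ModuleCat.{u} R) (i m n : ℕ) (h : m ≤ n) :
    Ext (T I m) M i →ₗ[R] Ext (T I n) M i :=
  (Ext.mk₀ (tr I m n h)).precompOfLinear R M (zero_add i)

lemma fE_apply (M : ModuleCat.{u} R) (i m n : ℕ) (h : m ≤ n) (a : Ext (T I m) M i) :
    fE I M i m n h a = (Ext.mk₀ (tr I m n h)).comp a (zero_add i) := rfl

instance (M : ModuleCat.{u} R) (i : ℕ) :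
    DirectedSystem (fun n => Ext (T I n) M i) (fun m n h => fE I M i m n h) where
  map_self n x := by
    simp [fE_apply, tr_self]
  map_map k j i h h' x := by
    simp only [fE_apply]
    rw [Ext.mk₀_comp_mk₀_assoc, tr_comp]

/-- Local cohomology as direct limit of Ext. -/
abbrev H (i : ℕ) (M : Type u) [AddCommGroup M] [Module R M] : Type u :=
  Module.DirectLimit (fun n => Ext (T I n) (ModuleCat.of R M) i)
    (fun m n h => fE I (ModuleCat.of R M) i m n h)

section
variable {M N P : Type u} [AddCommGroup M] [Module R M] [AddCommGroup N] [Module R N]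
  [AddCommGroup P] [Module R P]

noncomputable abbrev mkH (i n : ℕ) : Ext (T I n) (ModuleCat.of R M) i →ₗ[R] H I i M :=
  Module.DirectLimit.of R ℕ (fun n => Ext (T I n) (ModuleCat.of R M) i)
    (fun m n h => fE I (ModuleCat.of R M) i m n h) n

lemma mkH_surj {i : ℕ} (a : H I i M) : ∃ n e, mkH I i n e = a :=
  Module.DirectLimit.exists_of a

lemma mkH_f {i m n : ℕ} (h : m ≤ n) (e : Ext (T I m) (ModuleCat.of R M) i) :
    mkH I i n ((Ext.mk₀ (tr I m n h)).comp e (zero_add i)) = mkH I i m e :=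
  Module.DirectLimit.of_f (R := R) (ι := ℕ)
    (G := fun n => Ext (T I n) (ModuleCat.of R M) i)
    (f := fun m n h => fE I (ModuleCat.of R M) i m n h) (hij := h) (x := e)

lemma mkH_zero {i n : ℕ} (e : Ext (T I n) (ModuleCat.of R M) i) (h : mkH I i n e = 0) :
    ∃ k, ∃ h : n ≤ k, (Ext.mk₀ (tr I n k h)).comp e (zero_add i) = 0 :=
  Module.DirectLimit.of.zero_exact h

/-- postcomposition with an Ext class. -/
noncomputable def post {a n b : ℕ} (h : a + n = b)
    (β : Ext (ModuleCat.of R M) (ModuleCat.of R N) n) : H I a M →ₗ[R] H I b N :=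
  Module.DirectLimit.map (fun k => β.postcompOfLinear R (T I k) h) (by
    intro i j hij
    ext x
    simp only [LinearMap.comp_apply]
    change (Ext.comp (Ext.mk₀ (tr I i j hij)) x (zero_add a)).comp β h =
      Ext.comp (Ext.mk₀ (tr I i j hij)) (x.comp β h) (zero_add b)
    rw [Ext.comp_assoc]
    omega)

lemma post_mk {a n b : ℕ} (h : a + n = b)
    (β : Ext (ModuleCat.of R M) (ModuleCat.of R N) n) (k : ℕ)
    (e : Ext (T I k) (ModuleCat.of R M) a) :
    post I h β (mkH I a k e) = mkH I b k (e.comp β h) :=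
  Module.DirectLimit.map_apply_of _ _ _

lemma post_post {a n b n' c k : ℕ} (h : a + n = b) (h' : b + n' = c) (hk : n + n' = k)
    (β : Ext (ModuleCat.of R M) (ModuleCat.of R N) n)
    (γ : Ext (ModuleCat.of R N) (ModuleCat.of R P) n') (x : H I a M) :
    post I h' γ (post I h β x) = post I (by omega) (β.comp γ hk) x := by
  obtain ⟨j, e, rfl⟩ := mkH_surj I x
  rw [post_mk, post_mk, post_mk, Ext.comp_assoc]
  omega

/-- functoriality -/
noncomputable def map (i : ℕ) (f : M →ₗ[R] N) : H I i M →ₗ[R] H I i N :=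
  post I (add_zero i) (Ext.mk₀ (ModuleCat.ofHom f))

lemma map_id (i : ℕ) (x : H I i M) : map I i (LinearMap.id : M →ₗ[R] M) x = x := by
  obtain ⟨j, e, rfl⟩ := mkH_surj I x
  rw [map, post_mk]
  simp

lemma map_map (i : ℕ) (f : M →ₗ[R] N) (g : N →ₗ[R] P) (x : H I i M) :
    map I i g (map I i f x) = map I i (g ∘ₗ f) x := by
  rw [map, map, post_post I _ _ (zero_add 0), Ext.mk₀_comp_mk₀]; rfl

lemma map_add (i : ℕ) (f g : M →ₗ[R] N) (x : H I i M) :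
    map I i (f + g) x = map I i f x + map I i g x := by
  obtain ⟨j, e, rfl⟩ := mkH_surj I x
  rw [map, map, map, post_mk, post_mk, post_mk, ← _root_.map_add, ← Ext.comp_add, ← Ext.mk₀_add]
  rfl

lemma map_smul (i : ℕ) (r : R) (f : M →ₗ[R] N) (x : H I i M) :
    map I i (r • f) x = r • map I i f x := by
  obtain ⟨j, e, rfl⟩ := mkH_surj I x
  rw [map, map, post_mk, post_mk, ← _root_.map_smul, ← Ext.comp_smul, ← Ext.mk₀_smul]
  rfl

lemma map_zero (i : ℕ) (x : H I i M) : map I i (0 : M →ₗ[R] N) x = 0 := by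
  have := map_smul I i (0 : R) (0 : M →ₗ[R] N) x
  simpa using this

lemma map_sum (i : ℕ) {ι : Type*} (s : Finset ι) (f : ι → M →ₗ[R] N) (x : H I i M) :
    map I i (∑ j ∈ s, f j) x = ∑ j ∈ s, map I i (f j) x := by
  classical
  induction s using Finset.induction_on with
  | empty => simp [map_zero]
  | insert a s ha ih => rw [Finset.sum_insert ha, Finset.sum_insert ha, map_add, ih]

end

section LES
variable {A B C : Type u} [AddCommGroup A] [Module R A] [AddCommGroup B] [Module R B]
  [AddCommGroup C] [Module R C]

/-- the short complex attached to an exact sequence. -/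
noncomputable abbrev sc (f : A →ₗ[R] B) (g : B →ₗ[R] C) (hfg : Function.Exact f g) :
    ShortComplex (ModuleCat.{u} R) :=
  ShortComplex.mk (ModuleCat.ofHom f) (ModuleCat.ofHom g) (by
    ext x; exact hfg.apply_apply_eq_zero x)

lemma sc_se (f : A →ₗ[R] B) (g : B →ₗ[R] C) (hfg : Function.Exact f g)
    (hf : Function.Injective f) (hg : Function.Surjective g) : (sc f g hfg).ShortExact where
  exact := (ShortComplex.ShortExact.moduleCat_exact_iff_function_exact _).2 hfg
  mono_f := (ModuleCat.mono_iff_injective _).2 hf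
  epi_g := (ModuleCat.epi_iff_surjective _).2 hg

/-- the extension class. -/
noncomputable def ec (f : A →ₗ[R] B) (g : B →ₗ[R] C) (hfg : Function.Exact f g)
    (hf : Function.Injective f) (hg : Function.Surjective g) :
    Ext (ModuleCat.of R C) (ModuleCat.of R A) 1 := (sc_se f g hfg hf hg).extClass

/-- connecting map -/
noncomputable def δ (i : ℕ) (f : A →ₗ[R] B) (g : B →ₗ[R] C) (hfg : Function.Exact f g)
    (hf : Function.Injective f) (hg : Function.Surjective g) : H I i C →ₗ[R] H I (i + 1) A :=
  post I rfl (ec f g hfg hf hg)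

variable (f : A →ₗ[R] B) (g : B →ₗ[R] C) (hfg : Function.Exact f g)
    (hf : Function.Injective f) (hg : Function.Surjective g)

include hf hg hfg in
lemma exact_mid (i : ℕ) (x : H I i B) (hx : map I i g x = 0) : ∃ y, map I i f y = x := by
  obtain ⟨n, e, rfl⟩ := mkH_surj I x
  rw [map, post_mk] at hx
  obtain ⟨k, hk, h0⟩ := mkH_zero I _ hx
  rw [← Ext.comp_assoc (a₁₂ := i) (a₂₃ := i) _ _ _ (by omega) (by omega) (by omega)] at h0
  obtain ⟨y, hy⟩ := Ext.covariant_sequence_exact₂ _ (sc_se f g hfg hf hg) _ h0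
  refine ⟨mkH I i k y, ?_⟩
  rw [map, post_mk, ← mkH_f I hk, ← hy]

lemma exact_right (i : ℕ) (x : H I i C) (hx : δ I i f g hfg hf hg x = 0) :
    ∃ y, map I i g y = x := by
  obtain ⟨n, e, rfl⟩ := mkH_surj I x
  rw [δ, post_mk] at hx
  obtain ⟨k, hk, h0⟩ := mkH_zero I _ hx
  rw [← Ext.comp_assoc (a₁₂ := i) (a₂₃ := i + 1) _ _ _ (by omega) (by omega) (by omega)] at h0
  obtain ⟨y, hy⟩ := Ext.covariant_sequence_exact₃ _ (sc_se f g hfg hf hg) _ _ h0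
  refine ⟨mkH I i k y, ?_⟩
  rw [map, post_mk, ← mkH_f I hk, ← hy]

lemma exact_left (i : ℕ) (x : H I (i + 1) A) (hx : map I (i + 1) f x = 0) :
    ∃ y, δ I i f g hfg hf hg y = x := by
  obtain ⟨n, e, rfl⟩ := mkH_surj I x
  rw [map, post_mk] at hx
  obtain ⟨k, hk, h0⟩ := mkH_zero I _ hx
  rw [← Ext.comp_assoc (a₁₂ := i + 1) (a₂₃ := i + 1) _ _ _ (by omega) (by omega) (by omega)] at h0
  obtain ⟨y, hy⟩ := Ext.covariant_sequence_exact₁ _ (sc_se f g hfg hf hg) _ h0 rfl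
  refine ⟨mkH I i k y, ?_⟩
  rw [δ, post_mk, ← mkH_f I hk, ← hy]
  rfl

include hfg in
lemma map_map_zero (i : ℕ) (x : H I i A) : map I i g (map I i f x) = 0 := by
  rw [map_map]
  have : g ∘ₗ f = 0 := by ext a; exact hfg.apply_apply_eq_zero a
  rw [this, map_zero]

lemma δ_map (i : ℕ) (x : H I i B) : δ I i f g hfg hf hg (map I i g x) = 0 := by
  obtain ⟨n, e, rfl⟩ := mkH_surj I x
  rw [δ, map, post_mk, post_mk, Ext.comp_assoc (a₁₂ := i) (a₂₃ := 1) _ _ _ (by omega) (by omega) (by omega)]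
  have := (sc_se f g hfg hf hg).comp_extClass
  change (Ext.mk₀ (ModuleCat.ofHom g)).comp (ec f g hfg hf hg) _ = _ at this
  rw [this]; simp

lemma map_δ (i : ℕ) (x : H I i C) : map I (i + 1) f (δ I i f g hfg hf hg x) = 0 := by
  obtain ⟨n, e, rfl⟩ := mkH_surj I x
  rw [δ, map, post_mk, post_mk, Ext.comp_assoc (a₁₂ := i + 1) (a₂₃ := 1) _ _ _ (by omega) (by omega) (by omega)]
  have := (sc_se f g hfg hf hg).extClass_comp
  change Ext.comp (ec f g hfg hf hg) (Ext.mk₀ (ModuleCat.ofHom f)) _ = _ at this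
  rw [this]; simp

variable {A' B' C' : Type u} [AddCommGroup A'] [Module R A'] [AddCommGroup B'] [Module R B']
  [AddCommGroup C'] [Module R C']
variable (f' : A' →ₗ[R] B') (g' : B' →ₗ[R] C') (hfg' : Function.Exact f' g')
    (hf' : Function.Injective f') (hg' : Function.Surjective g')

lemma δ_nat (i : ℕ) (a : A →ₗ[R] A') (b : B →ₗ[R] B') (c : C →ₗ[R] C')
    (h1 : f' ∘ₗ a = b ∘ₗ f) (h2 : g' ∘ₗ b = c ∘ₗ g) (x : H I i C) :
    δ I i f' g' hfg' hf' hg' (map I i c x) = map I (i + 1) a (δ I i f g hfg hf hg x) := by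
  let φ : sc f g hfg ⟶ sc f' g' hfg' :=
    ShortComplex.homMk (ModuleCat.ofHom a) (ModuleCat.ofHom b) (ModuleCat.ofHom c)
      (by ext x; exact LinearMap.congr_fun h1 x)
      (by ext x; exact LinearMap.congr_fun h2 x)
  have := ShortComplex.ShortExact.extClass_naturality (sc_se f g hfg hf hg)
    (sc_se f' g' hfg' hf' hg') φ
  change Ext.comp (ec f g hfg hf hg) (Ext.mk₀ (ModuleCat.ofHom a)) _ =
    (Ext.mk₀ (ModuleCat.ofHom c)).comp (ec f' g' hfg' hf' hg') _ at this
  rw [δ, map, δ, map, post_post I _ _ (zero_add 1), post_post I _ _ (add_zero 1), this]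

end LES

section Props
variable {M N : Type u} [AddCommGroup M] [Module R M] [AddCommGroup N] [Module R N]

lemma torsion (i : ℕ) (x : H I i M) : ∃ n, ∀ r ∈ I ^ n, r • x = 0 := by
  obtain ⟨n, e, rfl⟩ := mkH_surj I x
  refine ⟨n, fun r hr => ?_⟩
  rw [← _root_.map_smul]
  have : r • e = (Ext.mk₀ (r • 𝟙 (T I n))).comp e (zero_add i) := by
    rw [Ext.mk₀_smul, Ext.smul_comp]; simp
  have h0 : (r • 𝟙 (T I n)) = 0 := by
    ext
    change r • (Ideal.Quotient.mk (I ^ n) 1) = 0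
    rw [← Ideal.Quotient.mk_eq_mk, ← Submodule.Quotient.mk_smul, Submodule.Quotient.mk_eq_zero]
    simpa using hr
  rw [this, h0]; simp

lemma subsingleton_of_inj (i : ℕ) (E : Type u) [AddCommGroup E] [Module R E]
    [Module.Injective R E] : Subsingleton (H I (i + 1) E) := by
  refine ⟨fun a b => ?_⟩
  have key : ∀ a : H I (i + 1) E, a = 0 := by
    intro a
    obtain ⟨n, e, rfl⟩ := mkH_surj I a
    have : CategoryTheory.Injective (ModuleCat.of R E) := Module.injective_object_of_injective_module R E
    rw [e.eq_zero_of_injective]; simp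
  rw [key a, key b]

/-- evaluation at 1 at finite stage. -/
noncomputable def ev0 (M : Type u) [AddCommGroup M] [Module R M] (n : ℕ) :
    Ext (T I n) (ModuleCat.of R M) 0 →ₗ[R] M where
  toFun e := (Ext.linearEquiv₀ (R := R) e).hom (Ideal.Quotient.mk (I ^ n) 1)
  map_add' a b := by simp
  map_smul' r a := by simp

lemma ev0_mk (n : ℕ) (φ : T I n ⟶ ModuleCat.of R M) :
    ev0 I M n (Ext.mk₀ φ) = φ.hom (Ideal.Quotient.mk (I ^ n) 1) := by
  have : Ext.linearEquiv₀ (R := R) (Ext.mk₀ φ) = φ := by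
    have := (Ext.linearEquiv₀ (R := R) (X := T I n) (Y := ModuleCat.of R M)).apply_symm_apply φ
    rwa [Ext.linearEquiv₀_symm_apply] at this
  change (Ext.linearEquiv₀ (R := R) (Ext.mk₀ φ)).hom _ = _
  rw [this]

/-- evaluation -/
noncomputable def ev (M : Type u) [AddCommGroup M] [Module R M] : H I 0 M →ₗ[R] M :=
  Module.DirectLimit.lift R ℕ _ _ (fun n => ev0 I M n) (by
    intro i j h x
    obtain ⟨φ, rfl⟩ := Ext.mk₀_bijective _ _ |>.2 x
    rw [fE_apply, Ext.mk₀_comp_mk₀, ev0_mk, ev0_mk]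
    rfl)

lemma ev_mk (n : ℕ) (φ : T I n ⟶ ModuleCat.of R M) :
    ev I M (mkH I 0 n (Ext.mk₀ φ)) = φ.hom (Ideal.Quotient.mk (I ^ n) 1) := by
  rw [ev, Module.DirectLimit.lift_of, ev0_mk]

lemma mkH0_surj (a : H I 0 M) : ∃ n, ∃ φ : T I n ⟶ ModuleCat.of R M, mkH I 0 n (Ext.mk₀ φ) = a := by
  obtain ⟨n, e, rfl⟩ := mkH_surj I a
  obtain ⟨φ, rfl⟩ := Ext.mk₀_bijective _ _ |>.2 e
  exact ⟨n, φ, rfl⟩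

lemma ev_nat (f : M →ₗ[R] N) (a : H I 0 M) : ev I N (map I 0 f a) = f (ev I M a) := by
  obtain ⟨n, φ, rfl⟩ := mkH0_surj I a
  rw [map, post_mk, Ext.mk₀_comp_mk₀, ev_mk, ev_mk]; rfl

lemma ev_inj : Function.Injective (ev I M) := by
  rw [injective_iff_map_eq_zero]
  intro a ha
  obtain ⟨n, φ, rfl⟩ := mkH0_surj I a
  rw [ev_mk] at ha
  have : φ = 0 := by
    ext
    exact ha
  rw [this]; simp

lemma ev_range (x : M) (n : ℕ) (hx : ∀ r ∈ I ^ n, r • x = 0) : ∃ a, ev I M a = x := by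
  let φ : (R ⧸ I ^ n) →ₗ[R] M := Submodule.liftQ _ (LinearMap.toSpanSingleton R M x) (by
    intro r hr; simpa using hx r hr)
  refine ⟨mkH I 0 n (Ext.mk₀ (ModuleCat.ofHom φ)), ?_⟩
  rw [ev_mk]
  change φ (Submodule.Quotient.mk 1) = x
  rw [Submodule.liftQ_apply]
  simp

end Props
end LC

namespace LC
open CategoryTheory CategoryTheory.Limits Opposite

variable {R : Type u} [CommRing R]

lemma formal {C : Type*} [Category C] {A B D A' B' D' : C} {a : A ⟶ A'} {b : A ⟶ B} {b' : A' ⟶ B'}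
    {h : B ⟶ B'} {c : B ⟶ D} {c' : B' ⟶ D'} {k : D ⟶ D'} (h1 : a ≫ b' = b ≫ h)
    (h2 : h ≫ c' = c ≫ k) : a ≫ (b' ≫ c') = (b ≫ c) ≫ k := by
  rw [← Category.assoc, h1, Category.assoc, h2, Category.assoc]

section cmp
variable {X : ModuleCat.{u} R} (P : ProjectiveResolution X) (Y : ModuleCat.{u} R) (n : ℕ)

/-- the Hom complex -/
noncomputable abbrev KC : CochainComplex (ModuleCat.{u} R) ℕ := P.complex.linearYonedaObj R Y

/-- underlying cocycle -/
noncomputable def cyc (z : (KC P Y).cycles n) : P.complex.X n ⟶ Y := (KC P Y).iCycles n z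

lemma cyc_inj {z w : (KC P Y).cycles n} (h : cyc P Y n z = cyc P Y n w) : z = w :=
  (ModuleCat.mono_iff_injective ((KC P Y).iCycles n)).1 inferInstance h

lemma cyc_d (z : (KC P Y).cycles n) : P.complex.d (n + 1) n ≫ cyc P Y n z = 0 := by
  have := congrArg (fun f => f.hom z) ((KC P Y).iCycles_d n (n + 1))
  exact this

lemma cyc_surj (f : P.complex.X n ⟶ Y) (hf : P.complex.d (n + 1) n ≫ f = 0) :
    ∃ z, cyc P Y n z = f :=
  ⟨(KC P Y).cyclesMk (i := n) f (n + 1) (by simp) hf,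
    (KC P Y).i_cyclesMk (i := n) f (n + 1) (by simp) hf⟩

lemma cyc_add (z w : (KC P Y).cycles n) : cyc P Y n (z + w) = cyc P Y n z + cyc P Y n w :=
  _root_.map_add ((KC P Y).iCycles n).hom z w

lemma cyc_smul (r : R) (z : (KC P Y).cycles n) : cyc P Y n (r • z) = r • cyc P Y n z :=
  _root_.map_smul ((KC P Y).iCycles n).hom r z

/-- new Ext from cocycles -/
noncomputable def αm : (KC P Y).cycles n →ₗ[R] Abelian.Ext X Y n where
  toFun z := P.extMk (cyc P Y n z) (n + 1) rfl (cyc_d P Y n z)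
  map_add' z w := by
    rw [P.add_extMk]
    congr 1
    exact cyc_add P Y n z w
  map_smul' r z := by
    have := P.extMk_comp_mk₀ (cyc P Y n z) (n + 1) rfl (cyc_d P Y n z) (r • 𝟙 Y)
    rw [Abelian.Ext.mk₀_smul, Abelian.Ext.comp_smul] at this
    simp only [Abelian.Ext.comp_mk₀_id, Linear.comp_smul, Category.comp_id] at this
    rw [RingHom.id_apply, this]
    congr 1
    exact cyc_smul P Y n r z

lemma αm_surj : Function.Surjective (αm P Y n) := by
  intro e
  obtain ⟨f, hf, rfl⟩ := P.extMk_surjective e (n + 1) rfl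
  obtain ⟨z, rfl⟩ := cyc_surj P Y n f hf
  exact ⟨z, rfl⟩

lemma αm_zero (z : (KC P Y).cycles (n + 1)) :
    αm P Y (n + 1) z = 0 ↔ ∃ g, (KC P Y).toCycles n (n + 1) g = z := by
  refine (P.extMk_eq_zero_iff _ _ rfl (cyc_d P Y (n + 1) z) n rfl).trans ?_
  refine exists_congr fun g => ?_
  have : cyc P Y (n + 1) ((KC P Y).toCycles n (n + 1) g) = P.complex.d (n + 1) n ≫ g := by
    have := congrArg (fun f => f.hom g) ((KC P Y).toCycles_i n (n + 1))
    exact this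
  rw [← this]
  exact ⟨cyc_inj P Y _, fun h => by rw [h]⟩

/-- old Ext -/
noncomputable abbrev OE (X Y : ModuleCat.{u} R) (n : ℕ) : ModuleCat.{u} R :=
  ((_root_.Ext R (ModuleCat.{u} R) n).obj (op X)).obj Y

/-- old Ext from cocycles -/
noncomputable def βm : (KC P Y).cycles n →ₗ[R] OE X Y n :=
  ((KC P Y).homologyπ n ≫ (P.isoExt n Y).inv).hom

lemma βm_surj : Function.Surjective (βm P Y n) :=
  (ModuleCat.epi_iff_surjective ((KC P Y).homologyπ n ≫ (P.isoExt (R := R) n Y).inv)).1 inferInstance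

lemma βm_zero (z : (KC P Y).cycles (n + 1)) :
    βm P Y (n + 1) z = 0 ↔ ∃ g, (KC P Y).toCycles n (n + 1) g = z := by
  have inj : Function.Injective (P.isoExt (R := R) (n + 1) Y).inv.hom :=
    (ModuleCat.mono_iff_injective (P.isoExt (R := R) (n + 1) Y).inv).1 inferInstance
  have h1 : βm P Y (n + 1) z = 0 ↔ ((KC P Y).homologyπ (n + 1)).hom z = 0 := by
    change (P.isoExt (R := R) (n + 1) Y).inv.hom (((KC P Y).homologyπ (n + 1)).hom z) = 0 ↔ _
    exact map_eq_zero_iff _ inj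
  rw [h1]
  have ex : (ShortComplex.mk _ _ ((KC P Y).toCycles_comp_homologyπ n (n + 1))).Exact :=
    ShortComplex.exact_of_g_is_cokernel _ ((KC P Y).homologyIsCokernel n (n + 1) (by simp))
  rw [ShortComplex.moduleCat_exact_iff] at ex
  constructor
  · intro h; exact ex z h
  · rintro ⟨g, rfl⟩
    exact congrArg (fun f => f.hom g) ((KC P Y).toCycles_comp_homologyπ n (n + 1))

/-- comparison -/
noncomputable def θ : Abelian.Ext X Y (n + 1) ≃ₗ[R] OE X Y (n + 1) :=
  ((αm P Y (n + 1)).quotKerEquivOfSurjective (αm_surj P Y _)).symm.trans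
    ((Submodule.quotEquivOfEq _ _ (by
      ext z; rw [LinearMap.mem_ker, LinearMap.mem_ker, αm_zero, βm_zero])).trans
    ((βm P Y (n + 1)).quotKerEquivOfSurjective (βm_surj P Y _)))

lemma θ_α (z : (KC P Y).cycles (n + 1)) : θ P Y n (αm P Y (n + 1) z) = βm P Y (n + 1) z := by
  have : ((αm P Y (n + 1)).quotKerEquivOfSurjective (αm_surj P Y _)).symm (αm P Y (n + 1) z) =
      Submodule.Quotient.mk z := by
    rw [LinearEquiv.symm_apply_eq]; rfl
  rw [θ, LinearEquiv.trans_apply, this]; rfl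

variable {X' : ModuleCat.{u} R} (P' : ProjectiveResolution X') (g : X' ⟶ X)
  (φ : ProjectiveResolution.Hom P' P g)

/-- induced map of Hom complexes -/
noncomputable def kmap : KC P Y ⟶ KC P' Y :=
  (HomologicalComplex.unopFunctor _ _).map
    (((((linearYoneda R (ModuleCat.{u} R)).obj Y).rightOp.mapHomologicalComplex _).map φ.hom)).op

lemma isoExt_nat : ((_root_.Ext R (ModuleCat.{u} R) n).map g.op).app Y ≫ (P'.isoExt n Y).hom =
    (P.isoExt n Y).hom ≫ HomologicalComplex.homologyMap (kmap P Y P' g φ) n := by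
  have h1 := ProjectiveResolution.isoLeftDerivedObj_inv_naturality g P' P φ.hom (by
    have := φ.hom_f_zero_comp_π_f_zero
    exact this) ((linearYoneda R (ModuleCat.{u} R)).obj Y).rightOp n
  have h2 := ShortComplex.homologyOpIso_inv_naturality
    ((HomologicalComplex.shortComplexFunctor (ModuleCat.{u} R) _ n).map (kmap P Y P' g φ))
  have h3 := congrArg Quiver.Hom.unop h1
  have h4 := congrArg Quiver.Hom.unop h2
  exact formal h3 h4.symm

lemma β_nat (z : (KC P Y).cycles n) :
    ((_root_.Ext R (ModuleCat.{u} R) n).map g.op).app Y (βm P Y n z) =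
      βm P' Y n (HomologicalComplex.cyclesMap (kmap P Y P' g φ) n z) := by
  have h : ((KC P Y).homologyπ n ≫ (P.isoExt n Y).inv) ≫
      ((_root_.Ext R (ModuleCat.{u} R) n).map g.op).app Y =
      HomologicalComplex.cyclesMap (kmap P Y P' g φ) n ≫
        ((KC P' Y).homologyπ n ≫ (P'.isoExt n Y).inv) := by
    rw [← Category.assoc, ← HomologicalComplex.homologyπ_naturality, Category.assoc, Category.assoc]
    congr 1
    rw [Iso.inv_comp_eq, ← Category.assoc, Iso.eq_comp_inv]
    exact isoExt_nat P Y n P' g φ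
  exact congrArg (fun f => f.hom z) h

lemma α_nat (z : (KC P Y).cycles n) :
    (Abelian.Ext.mk₀ g).comp (αm P Y n z) (zero_add n) =
      αm P' Y n (HomologicalComplex.cyclesMap (kmap P Y P' g φ) n z) := by
  refine (ProjectiveResolution.mk₀_comp_extMk _ _ rfl (cyc_d P Y n z) φ).trans ?_
  change _ = P'.extMk _ _ rfl (cyc_d P' Y n _)
  congr 1
  have := congrArg (fun f => f.hom z) (HomologicalComplex.cyclesMap_i (kmap P Y P' g φ) n)
  exact this.symm
include φ in
lemma θ_nat (e : Abelian.Ext X Y (n + 1)) :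
    θ P' Y n ((Abelian.Ext.mk₀ g).comp e (zero_add (n + 1))) =
      ((_root_.Ext R (ModuleCat.{u} R) (n + 1)).map g.op).app Y (θ P Y n e) := by
  obtain ⟨z, rfl⟩ := αm_surj P Y _ e
  rw [α_nat P Y (n + 1) P' g φ, θ_α, θ_α, β_nat P Y (n + 1) P' g φ]
end cmp

section lc
variable (I : Ideal R) (i : ℕ) (M : Type u) [AddCommGroup M] [Module R M]

/-- the diagram -/
noncomputable abbrev Dg : ℕᵒᵖᵒᵖ ⥤ ModuleCat.{u} R :=
  localCohomology.diagram (localCohomology.idealPowersDiagram I) (i + 1) ⋙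
    (evaluation _ _).obj (ModuleCat.of R M)

/-- its cocone -/
noncomputable def cc : Cocone (Dg I i M) :=
  ((evaluation _ _).obj (ModuleCat.of R M)).mapCocone
    (colimit.cocone (localCohomology.diagram (localCohomology.idealPowersDiagram I) (i + 1)))

noncomputable def ccC : IsColimit (cc I i M) :=
  isColimitOfPreserves _ (colimit.isColimit _)

lemma cc_pt : (cc I i M).pt = (localCohomology I (i + 1)).obj (ModuleCat.of R M) := rfl

/-- stage comparison -/
noncomputable def θn (n : ℕ) : Abelian.Ext (T I n) (ModuleCat.of R M) (i + 1) ≃ₗ[R]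
    (Dg I i M).obj (op (op n)) :=
  θ (projectiveResolution (T I n)) (ModuleCat.of R M) i

lemma θn_nat (m n : ℕ) (h : m ≤ n) (e : Abelian.Ext (T I m) (ModuleCat.of R M) (i + 1)) :
    θn I i M n (fE I (ModuleCat.of R M) (i + 1) m n h e) =
      (Dg I i M).map (homOfLE h).op.op (θn I i M m e) :=
  θ_nat (projectiveResolution (T I m)) (ModuleCat.of R M) i (projectiveResolution (T I n))
    (tr I m n h) (ProjectiveResolution.Hom.mk (ProjectiveResolution.lift (tr I m n h) _ _) (by
      have := ProjectiveResolution.lift_commutes (tr I m n h) (projectiveResolution (T I n))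
        (projectiveResolution (T I m))
      exact congrArg (fun f => f.f 0) this)) e

/-- comparison map -/
noncomputable def cmp : H I (i + 1) M →ₗ[R] (cc I i M).pt :=
  Module.DirectLimit.lift R ℕ _ _ (fun n => ((cc I i M).ι.app (op (op n))).hom ∘ₗ
      (θn I i M n).toLinearMap) (by
    intro m n h x
    have := congrArg (fun f => f.hom (θn I i M m x)) ((cc I i M).w (homOfLE h).op.op)
    simp only [LinearMap.comp_apply, LinearEquiv.coe_coe]
    rw [θn_nat]
    exact this)

lemma cmp_mk (n : ℕ) (e) : cmp I i M (mkH I (i + 1) n e) =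
    ((cc I i M).ι.app (op (op n))).hom (θn I i M n e) := by
  rw [cmp, Module.DirectLimit.lift_of]; rfl

lemma cmp_bij : Function.Bijective (cmp I i M) := by
  have : PreservesFilteredColimitsOfSize.{0, 0} (forget (ModuleCat.{u} R)) :=
    preservesFilteredColimitsOfSize_shrink.{0, u, 0, u} _
  have : PreservesColimitsOfShape ℕᵒᵖᵒᵖ (forget (ModuleCat.{u} R)) :=
    PreservesFilteredColimitsOfSize.preserves_filtered_colimits _
  constructor
  · rw [injective_iff_map_eq_zero]
    intro a ha
    obtain ⟨n, e, rfl⟩ := mkH_surj I a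
    rw [cmp_mk] at ha
    obtain ⟨k, f, g, hk⟩ := Concrete.isColimit_exists_of_rep_eq (Dg I i M) (ccC I i M)
      (x := θn I i M n e) (y := (0 : (Dg I i M).obj (op (op n))))
      (ha.trans (_root_.map_zero ((cc I i M).ι.app (op (op n))).hom).symm)
    have h : n ≤ k.unop.unop := leOfHom f.unop.unop
    have hf : f = (homOfLE h).op.op := Subsingleton.elim _ _
    subst hf
    have h2 := hk.trans (_root_.map_zero ((Dg I i M).map g).hom)
    have h3 := (θn_nat I i M n k.unop.unop h e).trans h2
    rw [LinearEquiv.map_eq_zero_iff] at h3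
    rw [← mkH_f I h]
    exact (congrArg _ h3).trans (_root_.map_zero _)
  · intro y
    obtain ⟨k, y, rfl⟩ := Concrete.isColimit_exists_rep (Dg I i M) (ccC I i M) y
    refine ⟨mkH I (i + 1) k.unop.unop ((θn I i M k.unop.unop).symm y), ?_⟩
    rw [cmp_mk, LinearEquiv.apply_symm_apply]

/-- the comparison -/
noncomputable def lcEquiv : H I (i + 1) M ≃ₗ[R]
    (localCohomology I (i + 1)).obj (ModuleCat.of R M) :=
  LinearEquiv.ofBijective (cmp I i M) (cmp_bij I i M)
end lc
end LC

namespace LC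
open IsLocalRing

/-- every element is killed by a power of the ideal. -/
def IsTors {R : Type u} [CommRing R] (I : Ideal R) (M : Type u) [AddCommGroup M] [Module R M] : Prop :=
  ∀ x : M, ∃ n, ∀ r ∈ I ^ n, r • x = 0

section tors
variable {R : Type u} [CommRing R] (I : Ideal R)

/-- torsion submodule -/
def Gam (E : Type u) [AddCommGroup E] [Module R E] : Submodule R E where
  carrier := {x | ∃ n, ∀ r ∈ I ^ n, r • x = 0}
  zero_mem' := ⟨0, by simp⟩
  add_mem' := by
    rintro a b ⟨n, hn⟩ ⟨m, hm⟩
    refine ⟨n + m, fun r hr => ?_⟩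
    rw [smul_add, hn r (Ideal.pow_le_pow_right (by omega) hr),
      hm r (Ideal.pow_le_pow_right (by omega) hr), add_zero]
  smul_mem' := by
    rintro c x ⟨n, hn⟩
    exact ⟨n, fun r hr => by rw [smul_comm, hn r hr, smul_zero]⟩

lemma Gam_tors (E : Type u) [AddCommGroup E] [Module R E] : IsTors I (Gam I E) := by
  rintro ⟨x, n, hn⟩
  exact ⟨n, fun r hr => Subtype.ext (hn r hr)⟩

variable {I} in
lemma IsTors.of_surj {A B : Type u} [AddCommGroup A] [Module R A] [AddCommGroup B] [Module R B]
    (h : IsTors I A) (f : A →ₗ[R] B) (hf : Function.Surjective f) : IsTors I B := by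
  intro y
  obtain ⟨x, rfl⟩ := hf y
  obtain ⟨n, hn⟩ := h x
  exact ⟨n, fun r hr => by rw [← _root_.map_smul, hn r hr, _root_.map_zero]⟩

variable {I} in
lemma IsTors.of_inj {A B : Type u} [AddCommGroup A] [Module R A] [AddCommGroup B] [Module R B]
    (h : IsTors I B) (f : A →ₗ[R] B) (hf : Function.Injective f) : IsTors I A := by
  intro y
  obtain ⟨n, hn⟩ := h (f y)
  exact ⟨n, fun r hr => hf (by rw [_root_.map_smul, hn r hr, _root_.map_zero])⟩

variable {I} in
lemma IsTors.exists_pow {A : Type u} [AddCommGroup A] [Module R A] [Module.Finite R A]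
    (h : IsTors I A) : ∃ n, ∀ r ∈ I ^ n, ∀ x : A, r • x = 0 := by
  obtain ⟨s, hs⟩ := (Module.Finite.fg_top : (⊤ : Submodule R A).FG)
  choose f hf using h
  refine ⟨s.sup f, fun r hr x => ?_⟩
  have : (⊤ : Submodule R A) ≤ LinearMap.ker (LinearMap.lsmul R A r) := by
    rw [← hs, Submodule.span_le]
    intro y hy
    exact hf y r (Ideal.pow_le_pow_right (Finset.le_sup hy) hr)
  exact this (Submodule.mem_top (x := x))

lemma Gam_inj [IsNoetherianRing R] (E : Type u) [AddCommGroup E] [Module R E]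
    [hE : Module.Injective R E] : Module.Injective R (Gam I E) := by
  apply Module.Baer.injective
  intro J g
  obtain ⟨n, hn⟩ := ((Gam_tors I E).of_inj (LinearMap.range g).subtype
    (Submodule.subtype_injective _)).exists_pow
  replace hn : ∀ r ∈ I ^ n, ∀ j : J, r • g j = 0 := fun r hr j =>
    congrArg Subtype.val (hn r hr ⟨g j, j, rfl⟩)
  obtain ⟨k, hk⟩ := I.exists_pow_inf_eq_pow_smul (J : Submodule R R)
  have key : ∀ j : J, (j : R) ∈ I ^ (n + k) → g j = 0 := by
    intro j hj
    have h1 : (j : R) ∈ I ^ n • (I ^ k • ⊤ ⊓ (J : Submodule R R)) := by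
      have := hk (n + k) (by omega)
      rw [Nat.add_sub_cancel] at this
      rw [← this]
      exact ⟨by simpa using hj, j.2⟩
    have h2 : (I ^ n • (I ^ k • ⊤ ⊓ (J : Submodule R R))) ≤
        Submodule.map J.subtype (LinearMap.ker g) := by
      rw [Submodule.smul_le]
      rintro r hr x ⟨-, hx⟩
      exact ⟨r • ⟨x, hx⟩, by rw [SetLike.mem_coe, LinearMap.mem_ker, _root_.map_smul, hn r hr], rfl⟩
    obtain ⟨j', hj', e⟩ := h2 h1
    have : j' = j := Subtype.ext e
    rw [← this]; exact hj'
  let f : (J ⧸ Submodule.comap J.subtype (I ^ (n + k) : Submodule R R)) →ₗ[R] R ⧸ I ^ (n + k) :=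
    Submodule.mapQ _ _ J.subtype le_rfl
  have hf : Function.Injective f := by
    rw [← LinearMap.ker_eq_bot, Submodule.ker_mapQ, Submodule.mkQ_map_self]
  let gg : (J ⧸ Submodule.comap J.subtype (I ^ (n + k) : Submodule R R)) →ₗ[R] E :=
    Submodule.liftQ _ ((Gam I E).subtype ∘ₗ g) (by
      intro j hj
      rw [LinearMap.mem_ker, LinearMap.comp_apply, key j hj, _root_.map_zero])
  obtain ⟨h, hh⟩ := hE.out f hf gg
  have he : ∀ r : R, r • h (Submodule.Quotient.mk 1) = h (Submodule.Quotient.mk r) := by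
    intro r
    rw [← _root_.map_smul, ← Submodule.Quotient.mk_smul]; simp
  refine ⟨LinearMap.toSpanSingleton R _ ⟨h (Submodule.Quotient.mk 1), n + k, fun r hr => ?_⟩, ?_⟩
  · rw [he, (Submodule.Quotient.mk_eq_zero _).2 hr, _root_.map_zero]
  · intro x hx
    apply Subtype.ext
    change x • h (Submodule.Quotient.mk 1) = _
    rw [he]
    exact hh (Submodule.Quotient.mk ⟨x, hx⟩)

lemma exists_inj_tors [IsNoetherianRing R] (N : Type u) [AddCommGroup N] [Module R N]
    (hN : IsTors I N) : ∃ (E : Type u) (_ : AddCommGroup E) (_ : Module R E),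
      Module.Injective R E ∧ IsTors I E ∧ ∃ f : N →ₗ[R] E, Function.Injective f := by
  let E := CategoryTheory.Injective.under (ModuleCat.of R N)
  have : Module.Injective R E := by
    have : CategoryTheory.Injective (ModuleCat.of R E) :=
      inferInstanceAs (CategoryTheory.Injective (CategoryTheory.Injective.under (ModuleCat.of R N)))
    exact Module.injective_module_of_injective_object R E
  let ι : N →ₗ[R] E := (CategoryTheory.Injective.ι (ModuleCat.of R N)).hom
  have hι : Function.Injective ι :=
    (ModuleCat.mono_iff_injective (CategoryTheory.Injective.ι (ModuleCat.of R N))).1 inferInstance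
  refine ⟨Gam I E, inferInstance, inferInstance, Gam_inj I E, Gam_tors I E,
    LinearMap.codRestrict _ ι ?_, ?_⟩
  · intro x
    obtain ⟨n, hn⟩ := hN x
    exact ⟨n, fun r hr => by rw [← _root_.map_smul, hn r hr, _root_.map_zero]⟩
  · intro a b h
    exact hι (congrArg Subtype.val h)

lemma H_tors [IsNoetherianRing R] (i : ℕ) : ∀ (N : Type u) [AddCommGroup N] [Module R N],
    IsTors I N → ∀ α : H I (i + 1) N, α = 0 := by
  induction i with
  | zero =>
    intro N _ _ hN α
    obtain ⟨E, _, _, hE, hET, f, hf⟩ := exists_inj_tors I N hN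
    have hfg := LinearMap.exact_map_mkQ_range f
    obtain ⟨β, rfl⟩ := exact_left I f (LinearMap.range f).mkQ hfg hf
      (Submodule.mkQ_surjective _) 0 α ((subsingleton_of_inj I 0 E).elim _ _)
    obtain ⟨e, he⟩ := Submodule.mkQ_surjective (LinearMap.range f) (ev I _ β)
    obtain ⟨n, hn⟩ := hET e
    obtain ⟨a, ha⟩ := ev_range I e n hn
    have : map I 0 (LinearMap.range f).mkQ a = β := by
      apply ev_inj I
      rw [ev_nat, ha, he]
    rw [← this, δ_map]
  | succ i ih =>
    intro N _ _ hN α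
    obtain ⟨E, _, _, hE, hET, f, hf⟩ := exists_inj_tors I N hN
    have hfg := LinearMap.exact_map_mkQ_range f
    obtain ⟨β, rfl⟩ := exact_left I f (LinearMap.range f).mkQ hfg hf
      (Submodule.mkQ_surjective _) (i + 1) α ((subsingleton_of_inj I _ E).elim _ _)
    rw [ih _ (hET.of_surj _ (Submodule.mkQ_surjective (LinearMap.range f))) β, _root_.map_zero]

section
variable {A B : Type u} [AddCommGroup A] [Module R A] [AddCommGroup B] [Module R B]
  (f : A →ₗ[R] B) (hf : Function.Surjective f)

include hf in
lemma map_inj_of_ker (i : ℕ) (h : ∀ α : H I i (LinearMap.ker f), α = 0) :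
    Function.Injective (map I i f) := by
  rw [injective_iff_map_eq_zero]
  intro a ha
  obtain ⟨y, rfl⟩ := exact_mid I (LinearMap.ker f).subtype f (LinearMap.exact_subtype_ker_map f)
    (Submodule.subtype_injective _) hf i a ha
  rw [h y, _root_.map_zero]

include hf in
lemma map_surj_of_ker (i : ℕ) (h : ∀ α : H I (i + 1) (LinearMap.ker f), α = 0) :
    Function.Surjective (map I i f) := by
  intro a
  exact exact_right I (LinearMap.ker f).subtype f (LinearMap.exact_subtype_ker_map f)
    (Submodule.subtype_injective _) hf i a (h _)

/-- linear equivalence induced -/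
noncomputable def mapE (i : ℕ) (e : A ≃ₗ[R] B) : H I i A ≃ₗ[R] H I i B :=
  LinearEquiv.ofLinearMap (map I i e.toLinearMap) (map I i e.symm.toLinearMap)
    (by refine LinearMap.ext fun x => ?_; rw [LinearMap.comp_apply, map_map]; simp [map_id])
    (by refine LinearMap.ext fun x => ?_; rw [LinearMap.comp_apply, map_map]; simp [map_id])
end
end tors

section dim
variable {R : Type u} [CommRing R] [IsLocalRing R] [IsNoetherianRing R]
variable (A : Type u) [AddCommGroup A] [Module R A] [Module.Finite R A]

lemma tors_of_dim (h : Module.supportDim R A ≤ 0) : IsTors (maximalIdeal R) A := by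
  intro u
  have hr : maximalIdeal R ≤ (Module.annihilator R A).radical := by
    rw [Ideal.radical_eq_sInf]
    refine le_sInf ?_
    rintro p ⟨hp, hpp⟩
    have hn : Nontrivial A := by
      by_contra hn
      rw [not_nontrivial_iff_subsingleton] at hn
      apply hpp.ne_top
      rw [Module.annihilator_eq_top_iff.2 hn] at hp
      exact top_le_iff.1 hp
    have h0 : Module.supportDim R A = 0 := by
      apply le_antisymm h
      have := Module.supportDim_ne_bot_of_nontrivial R A
      cases hh : Module.supportDim R A with
      | bot => exact absurd hh this
      | coe a => exact WithBot.coe_le_coe.2 (zero_le)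
    have hs := support_of_supportDim_eq_zero (R := R) (N := A) h0
    have : (⟨p, hpp⟩ : PrimeSpectrum R) ∈ Module.support R A := by
      rw [Module.support_eq_zeroLocus]; exact hp
    rw [hs] at this
    exact this
  obtain ⟨n, hn⟩ := Ideal.exists_pow_le_of_le_radical_of_fg hr (IsNoetherian.noetherian _)
  exact ⟨n, fun r hr => Module.mem_annihilator.1 (hn hr) u⟩

lemma dim_of_tors (h : IsTors (maximalIdeal R) A) : Module.supportDim R A ≤ 0 := by
  obtain ⟨n, hn⟩ := h.exists_pow
  have key : ∀ p : Module.support R A, p.1.asIdeal = maximalIdeal R := by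
    rintro ⟨p, hp⟩
    rw [Module.support_eq_zeroLocus] at hp
    apply le_antisymm (IsLocalRing.le_maximalIdeal p.2.ne_top)
    intro r hr
    exact p.2.mem_of_pow_mem n (hp (Module.mem_annihilator.2 (hn _ (Ideal.pow_mem_pow hr n))))
  have : Subsingleton (Module.support R A) :=
    ⟨fun a b => Subtype.ext (PrimeSpectrum.ext ((key a).trans (key b).symm))⟩
  exact Order.krullDim_nonpos_of_subsingleton

lemma fl_of_tors (h : IsTors (maximalIdeal R) A) : IsFiniteLength R A := by
  have h0 := dim_of_tors A h
  rw [Module.supportDim_eq_ringKrullDim_quotient_annihilator] at h0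
  have : Ring.KrullDimLE 0 (R ⧸ Module.annihilator R A) := Ring.krullDimLE_iff.2 h0
  have : IsArtinianRing (R ⧸ Module.annihilator R A) :=
    isArtinianRing_iff_krullDimLE_zero.2 this
  let _ : Module (R ⧸ Module.annihilator R A) A :=
    Module.IsTorsionBySet.module (Module.isTorsionBySet_annihilator R A)
  have : IsScalarTower R (R ⧸ Module.annihilator R A) A :=
    Module.IsTorsionBySet.isScalarTower _
  have : Module.Finite (R ⧸ Module.annihilator R A) A := Module.Finite.of_restrictScalars_finite R _ _
  have : IsArtinian (R ⧸ Module.annihilator R A) A := inferInstance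
  have : IsArtinian R A := by
    exact isArtinian_of_surjective_algebraMap (S := R) (R := R ⧸ Module.annihilator R A) Ideal.Quotient.mk_surjective
  rw [isFiniteLength_iff_isNoetherian_isArtinian]
  exact ⟨inferInstance, inferInstance⟩

omit [Module.Finite R A] in
lemma tors_of_fl (h : IsFiniteLength R A) : IsTors (maximalIdeal R) A := by
  rw [isFiniteLength_iff_isNoetherian_isArtinian] at h
  obtain ⟨_, _⟩ := h
  have anti : Antitone (fun n : ℕ => (maximalIdeal R) ^ n • (⊤ : Submodule R A)) := fun a b hab =>
    Submodule.smul_mono_left (Ideal.pow_le_pow_right hab)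
  obtain ⟨n, hn⟩ := IsArtinian.monotone_stabilizes ⟨fun n => OrderDual.toDual _, anti⟩
  have h1 : (maximalIdeal R) ^ n • (⊤ : Submodule R A) = (maximalIdeal R) ^ (n + 1) • ⊤ :=
    hn (n + 1) (by omega)
  have h2 : (maximalIdeal R) ^ n • (⊤ : Submodule R A) = ⊥ := by
    apply Submodule.eq_bot_of_le_smul_of_le_jacobson_bot (maximalIdeal R) _
      (IsNoetherian.noetherian _) _ (IsLocalRing.maximalIdeal_le_jacobson _)
    rw [← Submodule.mul_smul, ← pow_succ', ← h1]
  intro x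
  refine ⟨n, fun r hr => ?_⟩
  have : r • x ∈ (maximalIdeal R) ^ n • (⊤ : Submodule R A) :=
    Submodule.smul_mem_smul hr trivial
  rwa [h2] at this

lemma exists_av : ∃ x ∈ maximalIdeal R, ∀ p ∈ associatedPrimes R A, x ∈ p → p = maximalIdeal R := by
  have hfin : (associatedPrimes R A \ {maximalIdeal R}).Finite :=
    (associatedPrimes.finite R A).subset Set.sdiff_subset
  by_contra hcon
  push Not at hcon
  have hsub : ((maximalIdeal R : Ideal R) : Set R) ⊆
      ⋃ p ∈ (associatedPrimes R A \ {maximalIdeal R}), ((id p : Ideal R) : Set R) := by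
    intro x hx
    obtain ⟨p, hp, hxp, hne⟩ := hcon x hx
    exact Set.mem_biUnion (show p ∈ associatedPrimes R A \ {maximalIdeal R} from ⟨hp, hne⟩) hxp
  obtain ⟨p, hp, hle⟩ := (Ideal.subset_union_prime_finite hfin (f := id) 0 0
    (fun p hp _ _ => hp.1.isPrime)).1 hsub
  exact hp.2 (le_antisymm (IsLocalRing.le_maximalIdeal hp.1.isPrime.ne_top) hle)

/-- filter regular elements. -/
lemma fr_of_av (x : R) (hxp : ∀ p ∈ associatedPrimes R A, x ∈ p → p = maximalIdeal R) :
    (∀ n, IsTors (maximalIdeal R) (LinearMap.ker (LinearMap.lsmul R A (x ^ n)))) ∧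
    ∀ n, 0 < n → ∀ e : ℕ, Module.supportDim R A ≤ ((e + 1 : ℕ) : WithBot ℕ∞) →
      Module.supportDim R (QuotSMulTop (x ^ n) A) ≤ (e : WithBot ℕ∞) := by
  refine ⟨fun n => ?_, fun n hn e he => ?_⟩
  · rintro ⟨u, hu⟩
    have hr : maximalIdeal R ≤ (Module.annihilator R (Submodule.span R {u})).radical := by
      rw [← Ideal.sInf_minimalPrimes]
      refine le_sInf ?_
      intro p hp
      have h1 := Module.associatedPrimes.minimalPrimes_annihilator_subset_associatedPrimes R _ hp
      have h2 : p ∈ associatedPrimes R A :=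
        associatedPrimes.subset_of_injective (f := (Submodule.span R {u}).subtype)
          (Submodule.subtype_injective _) h1
      refine (hxp p h2 ?_).ge
      refine h2.isPrime.mem_of_pow_mem n (hp.1.2 ?_)
      rw [Submodule.mem_annihilator_span_singleton]
      exact hu
    obtain ⟨k, hk⟩ := Ideal.exists_pow_le_of_le_radical_of_fg hr (IsNoetherian.noetherian _)
    refine ⟨k, fun r hr => Subtype.ext ?_⟩
    exact (Submodule.mem_annihilator_span_singleton _ _).1 (hk hr)
  · by_cases hm : maximalIdeal R ∈ (Module.annihilator R A).minimalPrimes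
    · have ht : IsTors (maximalIdeal R) A := by
        have hr : maximalIdeal R ≤ (Module.annihilator R A).radical := by
          rw [Ideal.radical_eq_sInf]
          refine le_sInf ?_
          rintro p ⟨hp, hpp⟩
          exact hm.2 ⟨hpp, hp⟩ (IsLocalRing.le_maximalIdeal hpp.ne_top)
        obtain ⟨k, hk⟩ := Ideal.exists_pow_le_of_le_radical_of_fg hr (IsNoetherian.noetherian _)
        exact fun u => ⟨k, fun r hr => Module.mem_annihilator.1 (hk hr) u⟩
      refine (dim_of_tors _ (ht.of_surj _ (Submodule.mkQ_surjective _))).trans ?_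
      exact_mod_cast zero_le
    · have := Module.supportDim_quotSMulTop_succ_le_of_notMem_minimalPrimes (R := R) (M := A)
        (x := x ^ n) (by
          intro p hp hxn
          have h1 := Module.associatedPrimes.minimalPrimes_annihilator_subset_associatedPrimes R A hp
          have := hxp p h1 (h1.isPrime.mem_of_pow_mem n hxn)
          exact hm (this ▸ hp))
      have h2 := this.trans he
      cases hh : Module.supportDim R (QuotSMulTop (x ^ n) A) with
      | bot => exact bot_le
      | coe a =>
        rw [hh] at h2
        have h3 : a + 1 ≤ ((e + 1 : ℕ) : ℕ∞) := by exact_mod_cast h2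
        have h4 : a ≤ (e : ℕ∞) := by
          push_cast at h3
          exact (ENat.add_le_add_iff_right (by simp)).1 h3
        exact_mod_cast h4

lemma exists_fr : ∃ x ∈ maximalIdeal R,
    (∀ n, IsTors (maximalIdeal R) (LinearMap.ker (LinearMap.lsmul R A (x ^ n)))) ∧
    ∀ n, 0 < n → ∀ e : ℕ, Module.supportDim R A ≤ ((e + 1 : ℕ) : WithBot ℕ∞) →
      Module.supportDim R (QuotSMulTop (x ^ n) A) ≤ (e : WithBot ℕ∞) := by
  obtain ⟨x, hx, h⟩ := exists_av (R := R) A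
  exact ⟨x, hx, fr_of_av A x h⟩

variable (B : Type u) [AddCommGroup B] [Module R B] [Module.Finite R B] in
lemma exists_fr2 : ∃ x ∈ maximalIdeal R,
    (∀ n, IsTors (maximalIdeal R) (LinearMap.ker (LinearMap.lsmul R A (x ^ n)))) ∧
    ∀ n, 0 < n → ∀ e : ℕ, Module.supportDim R B ≤ ((e + 1 : ℕ) : WithBot ℕ∞) →
      Module.supportDim R (QuotSMulTop (x ^ n) B) ≤ (e : WithBot ℕ∞) := by
  obtain ⟨x, hx, h⟩ := exists_av (R := R) (A × B)
  refine ⟨x, hx, (fr_of_av A x fun p hp => h p ?_).1, (fr_of_av B x fun p hp => h p ?_).2⟩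
  · exact associatedPrimes.subset_of_injective (f := LinearMap.inl R A B) LinearMap.inl_injective hp
  · exact associatedPrimes.subset_of_injective (f := LinearMap.inr R A B) LinearMap.inr_injective hp
end dim
end LC

open Paper IsLocalRing
namespace LC
open scoped Pointwise
section mulx
variable {R : Type u} [CommRing R] (I : Ideal R) {M : Type u} [AddCommGroup M] [Module R M] (x : R)

/-- kernel of multiplication. -/
abbrev Ux (M : Type u) [AddCommGroup M] [Module R M] (x : R) : Submodule R M :=
  LinearMap.ker (LinearMap.lsmul R M x)

/-- induced injection. -/
noncomputable def jx (M : Type u) [AddCommGroup M] [Module R M] (x : R) : (M ⧸ Ux M x) →ₗ[R] M :=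
  Submodule.liftQ _ (LinearMap.lsmul R M x) le_rfl

lemma jx_mk (m : M) : jx M x ((Ux M x).mkQ m) = x • m := rfl

lemma jx_inj : Function.Injective (jx M x) := by
  rw [← LinearMap.ker_eq_bot]
  exact Submodule.ker_liftQ_eq_bot _ _ _ le_rfl

lemma jx_exact : Function.Exact (jx M x) (Submodule.mkQ (x • (⊤ : Submodule R M))) := by
  intro m
  rw [Submodule.mkQ_apply, Submodule.Quotient.mk_eq_zero, Submodule.mem_smul_pointwise_iff_exists]
  constructor
  · rintro ⟨b, -, rfl⟩
    exact ⟨(Ux M x).mkQ b, rfl⟩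
  · rintro ⟨b, rfl⟩
    obtain ⟨b, rfl⟩ := Submodule.mkQ_surjective _ b
    exact ⟨b, trivial, rfl⟩

lemma jx_map (i : ℕ) (α : H I i M) : map I i (jx M x) (map I i (Ux M x).mkQ α) = x • α := by
  rw [map_map]
  have : (jx M x) ∘ₗ (Ux M x).mkQ = x • LinearMap.id := LinearMap.ext fun m => rfl
  rw [this, map_smul, map_id]

/-- connecting map -/
noncomputable abbrev δx (M : Type u) [AddCommGroup M] [Module R M] (x : R) (i : ℕ) :
    H I i (QuotSMulTop x M) →ₗ[R] H I (i + 1) (M ⧸ Ux M x) :=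
  δ I i (jx M x) (Submodule.mkQ (x • (⊤ : Submodule R M))) (jx_exact x) (jx_inj x)
    (Submodule.mkQ_surjective _)

lemma ker_tors {N : Submodule R M} (h : IsTors I N) : IsTors I (LinearMap.ker N.mkQ) :=
  h.of_inj (Submodule.inclusion (Submodule.ker_mkQ N).le) (Submodule.inclusion_injective _)

lemma pi_inj [IsNoetherianRing R] (h : IsTors I (Ux M x)) (i : ℕ) :
    Function.Injective (map I (i + 1) (Ux M x).mkQ) :=
  map_inj_of_ker I _ (Submodule.mkQ_surjective _) _ fun α => H_tors I i _ (ker_tors I h) α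

lemma from_δ (i : ℕ) (α : H I (i + 1) M) (h : x • α = 0) :
    ∃ β, δx I M x i β = map I (i + 1) (Ux M x).mkQ α := by
  apply exact_left
  rw [jx_map, h]

end mulx

section V
variable {R : Type u} [CommRing R] [IsLocalRing R] [IsNoetherianRing R]

lemma exists_fr_kill (A : Type u) [AddCommGroup A] [Module R A] [Module.Finite R A]
    {N : Type u} [AddCommGroup N] [Module R N] (α : N) (h : ∃ n, ∀ r ∈ maximalIdeal R ^ n, r • α = 0) :
    ∃ y ∈ maximalIdeal R, y • α = 0 ∧ IsTors (maximalIdeal R) (Ux A y) ∧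
      ∀ e : ℕ, Module.supportDim R A ≤ ((e + 1 : ℕ) : WithBot ℕ∞) →
      Module.supportDim R (QuotSMulTop y A) ≤ (e : WithBot ℕ∞) := by
  obtain ⟨n, hn⟩ := h
  obtain ⟨x, hx, h1, h2⟩ := exists_fr (R := R) A
  exact ⟨x ^ (n + 1), Ideal.pow_mem_of_mem _ hx _ (by omega),
    hn _ (Ideal.pow_le_pow_right (by omega) (Ideal.pow_mem_pow hx (n + 1))), h1 _, h2 _ (by omega)⟩

lemma groth (i : ℕ) : ∀ (A : Type u) [AddCommGroup A] [Module R A] [Module.Finite R A],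
    Module.supportDim R A ≤ (i : WithBot ℕ∞) → ∀ α : H (maximalIdeal R) (i + 1) A, α = 0 := by
  induction i with
  | zero =>
    intro A _ _ _ h α
    exact H_tors _ 0 A (tors_of_dim A (by simpa using h)) α
  | succ i ih =>
    intro A _ _ _ h α
    obtain ⟨y, hy, hα, hU, hd⟩ := exists_fr_kill A α (torsion _ _ α)
    obtain ⟨β, hβ⟩ := from_δ _ y _ α hα
    apply pi_inj _ y hU
    rw [← hβ, ih _ (hd i h) β, _root_.map_zero, _root_.map_zero]

end V

section quot
variable {R : Type u} [CommRing R] {M N : Type u} [AddCommGroup M] [Module R M]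
  [AddCommGroup N] [Module R N] (f : M →ₗ[R] N) (hf : Function.Surjective f)
  (I : Ideal R) (hI : LinearMap.ker f = I • ⊤) (J : Ideal R)

include hf hI in
lemma comap_quot : Submodule.comap f (J • ⊤) = (I ⊔ J) • ⊤ := by
  have : (J • ⊤ : Submodule R N) = Submodule.map f (J • ⊤) := by
    rw [Submodule.map_smul'', Submodule.map_top, LinearMap.range_eq_top.2 hf]
  rw [this, Submodule.comap_map_eq, hI, sup_comm, Submodule.sup_smul]

include hf hI in
lemma mem_quot (u : M) : f u ∈ (J • ⊤ : Submodule R N) ↔ u ∈ ((I ⊔ J) • ⊤ : Submodule R M) := by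
  rw [← comap_quot f hf I hI J]; rfl

/-- iterated quotient. -/
noncomputable def quotE : (M ⧸ ((I ⊔ J) • ⊤ : Submodule R M)) ≃ₗ[R] N ⧸ (J • ⊤ : Submodule R N) :=
  (Submodule.quotEquivOfEq _ _ (by
    rw [LinearMap.ker_comp, Submodule.ker_mkQ, comap_quot f hf I hI J])).trans
    (((J • ⊤ : Submodule R N).mkQ ∘ₗ f).quotKerEquivOfSurjective
      ((Submodule.mkQ_surjective _).comp hf))

lemma quotE_mk (u : M) : quotE f hf I hI J (Submodule.Quotient.mk u) = Submodule.Quotient.mk (f u) := rfl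

end quot

section b
variable {R : Type u} [CommRing R] [IsLocalRing R]

lemma ker_qs {M : Type u} [AddCommGroup M] [Module R M] (x : R) :
    LinearMap.ker (Submodule.mkQ (x • (⊤ : Submodule R M))) = Ideal.span {x} • ⊤ := by
  rw [Submodule.ker_mkQ, Submodule.ideal_span_singleton_smul]

variable {M N : Type u} [AddCommGroup M] [Module R M] [AddCommGroup N] [Module R N]

lemma mem_b {d : ℕ} {r : R} : r ∈ bIdeal R M d ↔ ∀ x : Fin d → R, IsSOP R M d x → ∀ i : Fin d,
    ∀ u : M, x i • u ∈ (Ideal.span (x '' {j | j < i}) • ⊤ : Submodule R M) →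
      r • u ∈ (Ideal.span (x '' {j | j < i}) • ⊤ : Submodule R M) := by
  simp only [bIdeal, Submodule.mem_iInf, Module.mem_annihilator]
  refine forall_congr' fun x => forall_congr' fun hx => forall_congr' fun i => ?_
  constructor
  · intro h u hu
    have := congrArg Subtype.val (h ⟨Submodule.Quotient.mk u, by
      rw [Submodule.mem_torsionBy_iff, ← Submodule.Quotient.mk_smul]
      exact (Submodule.Quotient.mk_eq_zero _).2 hu⟩)
    exact (Submodule.Quotient.mk_eq_zero _).1 this
  · rintro h ⟨u, hu⟩
    obtain ⟨u, rfl⟩ := Submodule.mkQ_surjective _ u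
    apply Subtype.ext
    refine (Submodule.Quotient.mk_eq_zero _).2 (h u ?_)
    rw [Submodule.mem_torsionBy_iff] at hu
    exact (Submodule.Quotient.mk_eq_zero _).1 hu

variable (f : M →ₗ[R] N) (hf : Function.Surjective f)

include hf in
lemma sop_quot {d e : ℕ} (x : Fin d → R) (y : Fin e → R) (I : Ideal R)
    (hI : LinearMap.ker f = I • ⊤) (hx : ∀ i, x i ∈ maximalIdeal R) (hy : ∀ i, y i ∈ maximalIdeal R)
    (h : Ideal.span (Set.range x) = I ⊔ Ideal.span (Set.range y)) :
    IsSOP R M d x ↔ IsSOP R N e y := by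
  have E := quotE f hf I hI (Ideal.span (Set.range y))
  rw [← h] at E
  exact ⟨fun h => ⟨hy, E.isFiniteLength h.2⟩, fun h => ⟨hx, E.symm.isFiniteLength h.2⟩⟩

include hf in
lemma cons_sop {d : ℕ} (x : R) (y : Fin d → R) (hx : x ∈ maximalIdeal R)
    (hI : LinearMap.ker f = Ideal.span {x} • ⊤) :
    IsSOP R M (d + 1) (Fin.cons x y) ↔ IsSOP R N d y := by
  have aux : (∀ i, y i ∈ maximalIdeal R) → (IsSOP R M (d + 1) (Fin.cons x y) ↔ IsSOP R N d y) := by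
    intro hy
    refine sop_quot f hf _ _ _ hI (fun i => ?_) hy ?_
    · refine Fin.cases hx hy i
    · rw [Fin.range_cons, Set.insert_eq, Ideal.span_union]
  exact ⟨fun h => (aux fun i => by simpa using h.1 i.succ).1 h, fun h => (aux h.1).2 h⟩

include hf in
lemma b_quot {d : ℕ} (x : R) (hx : x ∈ maximalIdeal R)
    (hI : LinearMap.ker f = Ideal.span {x} • ⊤) : bIdeal R M (d + 1) ≤ bIdeal R N d := by
  intro r hr
  rw [mem_b] at hr ⊢
  intro y hy i u hu
  obtain ⟨u, rfl⟩ := hf u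
  have := hr _ ((cons_sop f hf x y hx hI).2 hy) i.succ u
  have e : (Fin.cons x y : Fin (d + 1) → R) '' {j | j < i.succ} = {x} ∪ y '' {j | j < i} := by
    ext z
    constructor
    · rintro ⟨j, hj, rfl⟩
      induction j using Fin.cases with
      | zero => left; rfl
      | succ j => right; exact ⟨j, by simpa using hj, by simp⟩
    · rintro (rfl | ⟨j, hj, rfl⟩)
      · exact ⟨0, by simp, by simp⟩
      · exact ⟨j.succ, by simpa using hj, by simp⟩
  rw [e, Ideal.span_union, ← mem_quot f hf _ hI, ← mem_quot f hf _ hI] at this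
  rw [← _root_.map_smul] at hu ⊢
  exact this (by simpa using hu)

lemma sop_equiv (e : M ≃ₗ[R] N) {d : ℕ} (x : Fin d → R) : IsSOP R M d x ↔ IsSOP R N d x := by
  have aux : (∀ i, x i ∈ maximalIdeal R) → (IsSOP R M d x ↔ IsSOP R N d x) := by
    intro hx
    exact sop_quot e.toLinearMap e.surjective x x ⊥ (by simp) hx hx (by simp)
  exact ⟨fun h => (aux h.1).1 h, fun h => (aux h.1).2 h⟩

lemma b_equiv_le (e : M ≃ₗ[R] N) (d : ℕ) : bIdeal R M d ≤ bIdeal R N d := by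
  intro r hr
  rw [mem_b] at hr ⊢
  intro y hy i u hu
  obtain ⟨u, rfl⟩ := e.surjective u
  have := hr _ ((sop_equiv e y).2 hy) i u
  have k : ∀ J : Ideal R, ∀ v : M, e v ∈ (J • ⊤ : Submodule R N) ↔ v ∈ (J • ⊤ : Submodule R M) := by
    intro J v
    have := mem_quot e.toLinearMap e.surjective ⊥ (by simp) J v
    rwa [bot_sup_eq] at this
  rw [← _root_.map_smul, k] at hu ⊢
  exact this hu

lemma b_equiv (e : M ≃ₗ[R] N) (d : ℕ) : bIdeal R M d = bIdeal R N d :=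
  le_antisymm (b_equiv_le e d) (b_equiv_le e.symm d)
end b
end LC

open Paper IsLocalRing
namespace LC
open scoped Pointwise
section C3
variable {R : Type u} [CommRing R] [IsLocalRing R] [IsNoetherianRing R]

lemma sop_zero_iff (M : Type u) [AddCommGroup M] [Module R M] [Module.Finite R M] (x : Fin 0 → R) :
    IsSOP R M 0 x ↔ IsTors (maximalIdeal R) M := by
  have E : (M ⧸ (Ideal.span (Set.range x) • ⊤ : Submodule R M)) ≃ₗ[R] M :=
    Submodule.quotEquivOfEqBot _ (by simp [Set.range_eq_empty])
  constructor
  · intro h; exact tors_of_fl M (E.isFiniteLength h.2)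
  · intro h; exact ⟨fun i => i.elim0, E.symm.isFiniteLength (fl_of_tors M h)⟩

lemma exists_sop (d : ℕ) : ∀ (M : Type u) [AddCommGroup M] [Module R M] [Module.Finite R M],
    Module.supportDim R M ≤ (d : WithBot ℕ∞) → ∃ x, IsSOP R M d x := by
  induction d with
  | zero =>
    intro M _ _ _ h
    exact ⟨Fin.elim0, (sop_zero_iff M _).2 (tors_of_dim M (by simpa using h))⟩
  | succ d ih =>
    intro M _ _ _ h
    obtain ⟨y, hy, -, -, h2⟩ := exists_fr_kill (R := R) M (0 : M) ⟨0, by simp⟩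
    obtain ⟨z, hz⟩ := ih _ (h2 d h)
    exact ⟨_, (cons_sop _ (Submodule.mkQ_surjective _) y z hy (ker_qs y)).2 hz⟩

lemma dim_of_sop (d : ℕ) : ∀ (M : Type u) [AddCommGroup M] [Module R M] [Module.Finite R M]
    (x : Fin d → R), IsSOP R M d x → Module.supportDim R M ≤ (d : WithBot ℕ∞) := by
  induction d with
  | zero =>
    intro M _ _ _ x h
    simpa using dim_of_tors M ((sop_zero_iff M x).1 h)
  | succ d ih =>
    intro M _ _ _ x h
    have hm : x 0 ∈ maximalIdeal R := h.1 0
    rw [← Fin.cons_self_tail x] at h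
    have := ih _ _ ((cons_sop _ (Submodule.mkQ_surjective _) _ _ hm (ker_qs _)).1 h)
    refine (Module.supportDim_le_supportDim_quotSMulTop_succ hm).trans ?_
    push_cast
    gcongr

/-- `b(M)` kills lower local cohomology. -/
lemma b_kill (i : ℕ) : ∀ (d : ℕ), i < d → ∀ (M : Type u) [AddCommGroup M] [Module R M]
    [Module.Finite R M], Module.supportDim R M ≤ (d : WithBot ℕ∞) → ∀ r ∈ bIdeal R M d,
    ∀ α : H (maximalIdeal R) i M, r • α = 0 := by
  induction i with
  | zero =>
    rintro (_ | d) hd M _ _ _ h r hr α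
    · omega
    obtain ⟨y, hy, hα, -, h2⟩ := exists_fr_kill (R := R) M α (torsion _ _ α)
    obtain ⟨z, hz⟩ := exists_sop _ _ (h2 d h)
    have hs := (cons_sop _ (Submodule.mkQ_surjective _) y z hy (ker_qs y)).2 hz
    apply ev_inj
    rw [_root_.map_smul, _root_.map_zero]
    have := mem_b.1 hr _ hs 0 (ev _ M α)
    simp only [Fin.not_lt_zero, Set.ofPred_false, Set.image_empty, Ideal.span_empty,
      Submodule.bot_smul, Submodule.mem_bot] at this
    apply this
    simp only [Fin.cons_zero]
    rw [← _root_.map_smul, hα, _root_.map_zero]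
  | succ i ih =>
    rintro (_ | d) hd M _ _ _ h r hr α
    · omega
    obtain ⟨y, hy, hα, hU, h2⟩ := exists_fr_kill (R := R) M α (torsion _ _ α)
    obtain ⟨β, hβ⟩ := from_δ _ y _ α hα
    apply pi_inj _ y hU
    have := ih d (by omega) _ (h2 d h) r
      (b_quot _ (Submodule.mkQ_surjective _) y hy (ker_qs y) hr) β
    rw [_root_.map_smul, ← hβ, ← _root_.map_smul, this, _root_.map_zero, _root_.map_zero]

lemma zero_of_tors (M : Type u) [AddCommGroup M] [Module R M]
    (h0 : ∀ α : H (maximalIdeal R) 0 M, α = 0) (u : M) (n : ℕ)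
    (hu : ∀ r ∈ maximalIdeal R ^ n, r • u = 0) : u = 0 := by
  obtain ⟨a, rfl⟩ := ev_range _ u n hu
  rw [h0 a, _root_.map_zero]

lemma Ux_bot (M : Type u) [AddCommGroup M] [Module R M]
    (h0 : ∀ α : H (maximalIdeal R) 0 M, α = 0) (x : R) (hU : IsTors (maximalIdeal R) (Ux M x)) :
    Ux M x = ⊥ := by
  rw [eq_bot_iff]
  intro u hu
  obtain ⟨n, hn⟩ := hU ⟨u, hu⟩
  exact zero_of_tors M h0 u n fun r hr => congrArg Subtype.val (hn r hr)

lemma lsmul_exact (M : Type u) [AddCommGroup M] [Module R M] (x : R) :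
    Function.Exact (LinearMap.lsmul R M x) (Submodule.mkQ (x • (⊤ : Submodule R M))) := by
  intro m
  rw [Submodule.mkQ_apply, Submodule.Quotient.mk_eq_zero, Submodule.mem_smul_pointwise_iff_exists]
  constructor
  · rintro ⟨b, -, rfl⟩
    exact ⟨b, rfl⟩
  · rintro ⟨b, rfl⟩
    exact ⟨b, trivial, rfl⟩

/-- vanishing descends along a regular element. -/
lemma van_quot (M : Type u) [AddCommGroup M] [Module R M] (x : R) (hU : Ux M x = ⊥) (n : ℕ)
    (h : ∀ i < n + 1, ∀ α : H (maximalIdeal R) i M, α = 0) :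
    ∀ i < n, ∀ α : H (maximalIdeal R) i (QuotSMulTop x M), α = 0 := by
  intro i hi α
  obtain ⟨β, rfl⟩ := exact_right (maximalIdeal R) _ _ (lsmul_exact M x) (LinearMap.ker_eq_bot.1 hU)
    (Submodule.mkQ_surjective _) i α (h _ (by omega) _)
  rw [h _ (by omega) β, _root_.map_zero]

lemma hom_zero (n : ℕ) : ∀ (M A : Type u) [AddCommGroup M] [Module R M] [Module.Finite R M]
    [AddCommGroup A] [Module R A] [Module.Finite R A],
    (∀ i < n + 1, ∀ α : H (maximalIdeal R) i M, α = 0) → Module.supportDim R A ≤ (n : WithBot ℕ∞) →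
    ∀ (f : A →ₗ[R] M) (a : A), f a = 0 := by
  induction n with
  | zero =>
    intro M A _ _ _ _ _ _ h hd f a
    obtain ⟨n, hn⟩ := tors_of_dim A (by simpa using hd) a
    exact zero_of_tors M (h 0 (by omega)) (f a) n fun r hr => by
      rw [← _root_.map_smul, hn r hr, _root_.map_zero]
  | succ n ih =>
    intro M A _ _ _ _ _ _ h hd
    obtain ⟨x, hx, hU, h2⟩ := exists_fr2 (R := R) M A
    have hU := Ux_bot M (h 0 (by omega)) _ (hU 1)
    have h2 := h2 1 (by omega) n hd
    rw [pow_one] at hU h2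
    have hinj : Function.Injective (LinearMap.lsmul R M x) := LinearMap.ker_eq_bot.1 hU
    have hQ := van_quot M x hU _ h
    have step : ∀ f : A →ₗ[R] M, ∃ g : A →ₗ[R] M, f = x • g := by
      intro f
      let fb : QuotSMulTop x A →ₗ[R] QuotSMulTop x M :=
        Submodule.mapQ _ _ f (by
          intro a ha
          rw [Submodule.mem_smul_pointwise_iff_exists] at ha
          obtain ⟨b, -, rfl⟩ := ha
          rw [Submodule.mem_comap, _root_.map_smul]
          exact Submodule.smul_mem_pointwise_smul _ _ _ trivial)
      have hr : ∀ a, f a ∈ LinearMap.range (LinearMap.lsmul R M x) := by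
        intro a
        have : fb (Submodule.Quotient.mk a) = 0 := ih _ _ hQ h2 fb _
        exact (lsmul_exact M x _).1 this
      refine ⟨(LinearEquiv.ofInjective _ hinj).symm.toLinearMap ∘ₗ LinearMap.codRestrict _ f hr, ?_⟩
      ext a
      have := LinearEquiv.apply_symm_apply (LinearEquiv.ofInjective _ hinj)
        (LinearMap.codRestrict _ f hr a)
      exact (congrArg Subtype.val this).symm
    have key : ∀ k : ℕ, ∀ (f : A →ₗ[R] M) (a : A), f a ∈ (maximalIdeal R ^ k • ⊤ : Submodule R M) := by
      intro k
      induction k with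
      | zero => intro f a; simp
      | succ k ihk =>
        intro f a
        obtain ⟨g, rfl⟩ := step f
        rw [pow_succ', Submodule.mul_smul]
        exact Submodule.smul_mem_smul hx (ihk g a)
    intro f a
    have : f a ∈ (⨅ i, maximalIdeal R ^ i • ⊤ : Submodule R M) := by
      rw [Submodule.mem_iInf]; exact fun k => key k f a
    rwa [Ideal.iInf_pow_smul_eq_bot_of_isLocalRing _ (Ideal.IsPrime.ne_top'), Submodule.mem_bot] at this

lemma van_of_reg (rs : List R) : ∀ (M : Type u) [AddCommGroup M] [Module R M],
    (∀ r ∈ rs, r ∈ maximalIdeal R) → RingTheory.Sequence.IsWeaklyRegular M rs →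
    ∀ i < rs.length, ∀ α : H (maximalIdeal R) i M, α = 0 := by
  induction rs with
  | nil => intro M _ _ _ _ i hi; simp at hi
  | cons r rs ih =>
    intro M _ _ hm hr i hi α
    rw [RingTheory.Sequence.isWeaklyRegular_cons_iff] at hr
    have hinj : Function.Injective (LinearMap.lsmul R M r) := hr.1
    have hrm : r ∈ maximalIdeal R := hm r (by simp)
    -- multiplication by r is injective on H^i
    have key : ∀ α : H (maximalIdeal R) i M, r • α = 0 → α = 0 := by
      intro α hα
      have hm' : map (maximalIdeal R) i (LinearMap.lsmul R M r) α = 0 := by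
        have e : LinearMap.lsmul R M r = r • LinearMap.id := LinearMap.ext fun m => rfl
        rw [e, map_smul, map_id, hα]
      cases i with
      | zero =>
        apply ev_inj
        apply hinj
        simp only [← ev_nat, hm', _root_.map_zero]
      | succ i =>
        obtain ⟨β, rfl⟩ := exact_left (maximalIdeal R) _ _ (lsmul_exact M r) hinj
          (Submodule.mkQ_surjective _) i α hm'
        rw [ih (QuotSMulTop r M) (fun s hs => hm s (by simp [hs])) hr.2 i (by simpa using hi) β,
          _root_.map_zero]
    obtain ⟨n, hn⟩ := torsion _ _ α
    have h1 := hn _ (Ideal.pow_mem_pow hrm n)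
    clear hn
    induction n with
    | zero => simpa using h1
    | succ n ihn =>
      apply ihn
      apply key
      rw [smul_smul, ← pow_succ', h1]

lemma reg_of_van (d : ℕ) : ∀ (M : Type u) [AddCommGroup M] [Module R M] [Module.Finite R M],
    (∀ i < d, ∀ α : H (maximalIdeal R) i M, α = 0) →
    ∃ rs : List R, rs.length = d ∧ (∀ r ∈ rs, r ∈ maximalIdeal R) ∧
      RingTheory.Sequence.IsWeaklyRegular M rs := by
  induction d with
  | zero => intro M _ _ _ _; exact ⟨[], by simp⟩
  | succ d ih =>
    intro M _ _ _ h
    obtain ⟨x, hx, hxa, hU, h2⟩ := exists_fr_kill (R := R) M (0 : M) ⟨0, by simp⟩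
    have hU := Ux_bot M (h 0 (by omega)) _ hU
    obtain ⟨rs, h3, h4, h5⟩ := ih _ (van_quot M x hU d h)
    refine ⟨x :: rs, by simp [h3], ?_, ?_⟩
    · intro r hr
      rcases List.mem_cons.1 hr with rfl | hr
      · exact hx
      · exact h4 _ hr
    · rw [RingTheory.Sequence.isWeaklyRegular_cons_iff]
      exact ⟨(LinearMap.ker_eq_bot.1 hU : Function.Injective (LinearMap.lsmul R M x)), h5⟩

lemma isCM_iff (M : Type u) [AddCommGroup M] [Module R M] [Module.Finite R M] (d : ℕ)
    (hd : mdim R M = d) : IsCM R M ↔ ∀ i < d, ∀ α : H (maximalIdeal R) i M, α = 0 := by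
  have hdim : Module.supportDim R M = d := by
    rw [Module.supportDim_eq_ringKrullDim_quotient_annihilator]; exact hd
  have hnt : Nontrivial M := by
    rw [← Module.supportDim_ne_bot_iff_nontrivial R, hdim]
    exact WithBot.natCast_ne_bot _
  have hle : ∀ rs : List R, RingTheory.Sequence.IsRegular M rs → rs.length ≤ d := by
    intro rs hr
    have h1 := Module.supportDim_add_length_eq_supportDim_of_isRegular rs hr
    rw [hdim] at h1
    have : Nontrivial (M ⧸ (Ideal.ofList rs • ⊤ : Submodule R M)) := hr.quot_ofList_smul_nontrivial ⊤
    have h2 := Module.supportDim_ne_bot_of_nontrivial R (M ⧸ (Ideal.ofList rs • ⊤ : Submodule R M))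
    cases hh : Module.supportDim R (M ⧸ (Ideal.ofList rs • ⊤ : Submodule R M)) with
    | bot => exact absurd hh h2
    | coe a =>
      rw [hh] at h1
      have h3 : a + (rs.length : ℕ∞) = (d : ℕ∞) := by exact_mod_cast h1
      have : (rs.length : ℕ∞) ≤ d := by rw [← h3]; exact le_add_self
      exact_mod_cast this
  set S : Set (WithTop ℕ) := {n : WithTop ℕ | ∃ rs : List R, (rs.length : WithTop ℕ) = n ∧
    (∀ r ∈ rs, r ∈ maximalIdeal R) ∧ RingTheory.Sequence.IsRegular M rs} with hS
  have hbd : ∀ n ∈ S, n ≤ (d : WithTop ℕ) := by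
    rintro n ⟨rs, rfl, h1, h2⟩
    exact_mod_cast hle rs h2
  have hiff : IsCM R M ↔ sSup S = (d : WithTop ℕ) := by
    rw [IsCM, hd, depth]
    exact WithBot.coe_inj (b := (d : WithTop ℕ))
  rw [hiff]
  constructor
  · intro h
    have hmem : (d : WithTop ℕ) ∈ S := by
      by_contra hcon
      rcases d with _ | d
      · exact hcon ⟨[], by simp, by simp, RingTheory.Sequence.IsRegular.nil R M⟩
      · have : sSup S ≤ (d : WithTop ℕ) := by
          apply csSup_le'
          rintro n hn
          have h1 := hbd n hn
          obtain ⟨rs, rfl, h3, h4⟩ := hn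
          have h1 : rs.length ≤ d + 1 := by exact_mod_cast h1
          have : rs.length ≠ d + 1 := by
            intro e; apply hcon; rw [← e]; exact ⟨rs, rfl, h3, h4⟩
          exact_mod_cast (show rs.length ≤ d by omega)
        rw [h] at this
        have : d + 1 ≤ d := by exact_mod_cast this
        omega
    obtain ⟨rs, h1, h2, h3⟩ := hmem
    have h1 : rs.length = d := by exact_mod_cast h1
    have := van_of_reg rs M h2 h3.toIsWeaklyRegular
    rwa [h1] at this
  · intro h
    obtain ⟨rs, h1, h2, h3⟩ := reg_of_van d M h
    apply le_antisymm (csSup_le' hbd)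
    refine le_csSup ⟨d, hbd⟩ ⟨rs, by rw [h1], h2, ?_⟩
    exact RingTheory.Sequence.IsRegular.of_isWeaklyRegular_of_mem_maximalIdeal _ h2 h3

end C3
end LC

open Paper IsLocalRing
namespace LC
open scoped Pointwise
section D1
variable (R : Type u) [CommRing R] [IsLocalRing R]

/-- length of the socle. -/
noncomputable def sl (N : Type u) [AddCommGroup N] [Module R N] : ℕ∞ :=
  Module.length R (Submodule.torsionBySet R N (maximalIdeal R : Set R))

variable {N N1 N2 N3 : Type u} [AddCommGroup N] [Module R N] [AddCommGroup N1] [Module R N1]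
  [AddCommGroup N2] [Module R N2] [AddCommGroup N3] [Module R N3]

variable {R}

lemma mem_soc {a : N} : a ∈ Submodule.torsionBySet R N (maximalIdeal R : Set R) ↔
    ∀ r ∈ maximalIdeal R, r • a = 0 := by
  rw [Submodule.mem_torsionBySet_iff]
  exact ⟨fun h r hr => h ⟨r, hr⟩, fun h r => h r.1 r.2⟩

/-- map induced on socles -/
def socMap (f : N1 →ₗ[R] N2) : Submodule.torsionBySet R N1 (maximalIdeal R : Set R) →ₗ[R]
    Submodule.torsionBySet R N2 (maximalIdeal R : Set R) :=
  f.restrict fun a ha => by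
    rw [mem_soc] at ha ⊢
    intro r hr
    rw [← _root_.map_smul, ha r hr, _root_.map_zero]

lemma sl_add (f : N1 →ₗ[R] N2) (g : N2 →ₗ[R] N3) (hf : Function.Injective f)
    (h0 : ∀ a, g (f a) = 0) (h1 : ∀ b, g b = 0 → ∃ a, f a = b)
    (h2 : ∀ c, (∀ r ∈ maximalIdeal R, r • c = 0) → ∃ b, (∀ r ∈ maximalIdeal R, r • b = 0) ∧ g b = c) :
    sl R N2 = sl R N1 + sl R N3 := by
  refine Module.length_eq_add_of_exact (socMap f) (socMap g) ?_ ?_ ?_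
  · intro a b h
    exact Subtype.ext (hf (congrArg Subtype.val h))
  · rintro ⟨c, hc⟩
    obtain ⟨b, hb, rfl⟩ := h2 c (mem_soc.1 hc)
    exact ⟨⟨b, mem_soc.2 hb⟩, rfl⟩
  · rintro ⟨b, hb⟩
    constructor
    · intro h
      obtain ⟨a, rfl⟩ := h1 b (congrArg Subtype.val h)
      refine ⟨⟨a, mem_soc.2 fun r hr => hf ?_⟩, rfl⟩
      rw [_root_.map_smul, mem_soc.1 hb r hr, _root_.map_zero]
    · rintro ⟨a, ha⟩
      rw [← ha]
      exact Subtype.ext (h0 a)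

lemma sl_equiv (e : N1 ≃ₗ[R] N2) : sl R N1 = sl R N2 := by
  apply le_antisymm
  · exact Module.length_le_of_injective (socMap e.toLinearMap) fun a b h =>
      Subtype.ext (e.injective (congrArg Subtype.val h))
  · exact Module.length_le_of_injective (socMap e.symm.toLinearMap) fun a b h =>
      Subtype.ext (e.symm.injective (congrArg Subtype.val h))

lemma sl_fin (h : IsFiniteLength R N) : sl R N ≠ ⊤ :=
  Module.length_ne_top_iff.2 (h.of_injective (Submodule.subtype_injective _))

lemma sl_socDim (h : sl R N ≠ ⊤) : (socDim R (maximalIdeal R) N : ℕ∞) = sl R N := by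
  let _ : Field (R ⧸ maximalIdeal R) := Ideal.Quotient.field _
  have h1 := Module.length_eq_of_surjective (S := R) (R := R ⧸ maximalIdeal R)
    (M := Submodule.torsionBySet R N (maximalIdeal R : Set R)) Ideal.Quotient.mk_surjective
  have h2 : Module.Finite (R ⧸ maximalIdeal R)
      (Submodule.torsionBySet R N (maximalIdeal R : Set R)) := by
    have h3 : Module.length (R ⧸ maximalIdeal R)
      (Submodule.torsionBySet R N (maximalIdeal R : Set R)) ≠ ⊤ := by rw [← h1]; exact h
    have := (isFiniteLength_iff_isNoetherian_isArtinian.1 (Module.length_ne_top_iff.1 h3)).1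
    infer_instance
  rw [sl, h1]
  exact (Module.length_eq_finrank (R ⧸ maximalIdeal R) _).symm

lemma zero_of_sl (ht : IsTors (maximalIdeal R) N) (h : sl R N = 0) (a : N) : a = 0 := by
  rw [sl, Module.length_eq_zero_iff] at h
  obtain ⟨n, hn⟩ := ht a
  induction n generalizing a with
  | zero => simpa using hn 1 (by simp)
  | succ n ih =>
    have : a ∈ Submodule.torsionBySet R N (maximalIdeal R : Set R) := by
      rw [mem_soc]
      intro r hr
      apply ih
      intro s hs
      rw [smul_smul]
      exact hn _ (by rw [pow_succ]; exact Ideal.mul_mem_mul hs hr)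
    exact congrArg Subtype.val (h.elim ⟨a, this⟩ 0)

lemma sl_zero (h : ∀ a : N, a = 0) : sl R N = 0 := by
  rw [sl, Module.length_eq_zero_iff]
  exact ⟨fun a b => Subtype.ext ((h a).trans (h b).symm)⟩
end D1

section D2
variable {R : Type u} [CommRing R] [IsLocalRing R] [IsNoetherianRing R]
variable (M : Type u) [AddCommGroup M] [Module R M] [Module.Finite R M] (x : R) (d : ℕ)

omit [IsLocalRing R] in
lemma dim_Ux : Module.supportDim R (Ux M x) ≤ Module.supportDim R (QuotSMulTop x M) := by
  have hs : Module.support R (Ux M x) ⊆ Module.support R (QuotSMulTop x M) := by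
    rw [Module.support_quotSMulTop]
    refine Set.subset_inter (Module.support_subset_of_injective (Ux M x).subtype
      (Submodule.subtype_injective _)) ?_
    rw [Module.support_eq_zeroLocus]
    apply PrimeSpectrum.zeroLocus_anti_mono
    rw [Set.singleton_subset_iff]
    exact Module.mem_annihilator.2 fun u => Subtype.ext u.2
  exact Order.krullDim_le_of_strictMono (Set.inclusion hs) fun a b h => h

variable (hM : Module.supportDim R M ≤ ((d + 1 : ℕ) : WithBot ℕ∞))
  (hQ : Module.supportDim R (QuotSMulTop x M) ≤ (d : WithBot ℕ∞))
  (hxm : x ∈ maximalIdeal R) (hxb : x ∈ (bIdeal R M (d + 1)) ^ 3)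

include hQ in
lemma pi_bij : Function.Bijective (map (maximalIdeal R) (d + 1) (Ux M x).mkQ) := by
  have hk : Module.supportDim R (LinearMap.ker (Ux M x).mkQ) ≤ (d : WithBot ℕ∞) :=
    (Module.supportDim_le_of_injective (Submodule.inclusion (Submodule.ker_mkQ (Ux M x)).le)
      (Submodule.inclusion_injective _)).trans ((dim_Ux M x).trans hQ)
  refine ⟨map_inj_of_ker _ _ (Submodule.mkQ_surjective _) _ (groth d _ hk),
    map_surj_of_ker _ _ (Submodule.mkQ_surjective _) _ (groth (d + 1) _ (hk.trans ?_))⟩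
  exact_mod_cast Nat.le_succ d

include hQ hxm in
lemma b_Ux (r : R) (hr : r ∈ bIdeal R M (d + 1)) (u : M) (hu : x • u = 0) : r • u = 0 := by
  obtain ⟨z, hz⟩ := exists_sop _ _ hQ
  have hs := (cons_sop _ (Submodule.mkQ_surjective _) x z hxm (ker_qs x)).2 hz
  have := mem_b.1 hr _ hs 0 u
  simp only [Fin.not_lt_zero, Set.ofPred_false, Set.image_empty, Ideal.span_empty,
    Submodule.bot_smul, Submodule.mem_bot] at this
  exact this hu

omit [IsNoetherianRing R] [Module.Finite R M] in
include hxm hxb in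
lemma decomp : ∃ (ι : Type u) (_ : Fintype ι) (a b : ι → R),
    (∀ j, a j ∈ bIdeal R M (d + 1)) ∧ (∀ j, a j ∈ maximalIdeal R) ∧
    (∀ j, b j ∈ bIdeal R M (d + 1)) ∧ x = ∑ j, b j * a j := by
  set 𝔟 := bIdeal R M (d + 1) with h𝔟
  have h1 : x ∈ (𝔟 ⊓ maximalIdeal R) * 𝔟 := by
    by_cases ht : 𝔟 = ⊤
    · rw [ht]; simpa using hxm
    · have hle : 𝔟 ≤ maximalIdeal R := IsLocalRing.le_maximalIdeal ht
      rw [inf_eq_left.2 hle, ← pow_two]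
      exact Ideal.pow_le_pow_right (by omega) hxb
  have h2 : x ∈ (𝔟 ⊓ maximalIdeal R) • Submodule.span R (Set.range (Subtype.val : 𝔟 → R)) := by
    rw [Subtype.range_coe, Submodule.span_eq]
    exact h1
  rw [Submodule.mem_ideal_smul_span_iff_exists_sum] at h2
  obtain ⟨a, ha, hs⟩ := h2
  refine ⟨a.support, inferInstance, fun j => a j.1, fun j => j.1.1, fun j => (ha _).1,
    fun j => (ha _).2, fun j => j.1.2, ?_⟩
  rw [← hs, Finsupp.sum, ← Finset.sum_coe_sort]
  exact Finset.sum_congr rfl fun j _ => mul_comm _ _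

include hM hQ hxm hxb in
lemma step : (∀ i < d + 1, Function.Injective (map (maximalIdeal R) i
      (Submodule.mkQ (x • (⊤ : Submodule R M))))) ∧
    ∀ α : H (maximalIdeal R) (d + 1) (M ⧸ Ux M x), (∀ r ∈ maximalIdeal R, r • α = 0) →
      ∃ β, (∀ r ∈ maximalIdeal R, r • β = 0) ∧ δx (maximalIdeal R) M x d β = α := by
  obtain ⟨ι, _, a, b, ha, ham, hb, hsum⟩ := decomp M x d hxm hxb
  classical
  let φ0 : M →ₗ[R] (ι → M) := LinearMap.pi fun j => a j • LinearMap.id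
  let φ : (M ⧸ Ux M x) →ₗ[R] (ι → M) := Submodule.liftQ _ φ0 (by
    intro u hu
    rw [LinearMap.mem_ker]
    funext j
    exact b_Ux M x d hQ hxm _ (ha j) u hu)
  let B : (ι → M) →ₗ[R] M := ∑ j, b j • LinearMap.proj j
  have hBφ : jx M x = B ∘ₗ φ := by
    apply Submodule.linearMap_qext
    ext u
    change x • u = B (φ0 u)
    simp only [B, φ0, LinearMap.sum_apply, LinearMap.smul_apply, LinearMap.proj_apply,
      LinearMap.pi_apply, LinearMap.id_apply, smul_smul]
    rw [← Finset.sum_smul, ← hsum]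
  have hφ : Function.Injective φ := by
    have := jx_inj (M := M) x
    rw [hBφ] at this
    exact Function.Injective.of_comp this
  have hB : ∀ i < d + 1, ∀ γ : H (maximalIdeal R) i (ι → M), map (maximalIdeal R) i B γ = 0 := by
    intro i hi γ
    rw [map_sum]
    refine Finset.sum_eq_zero fun j _ => ?_
    rw [map_smul]
    exact b_kill i (d + 1) hi M hM _ (hb j) _
  constructor
  · intro i hi
    rw [injective_iff_map_eq_zero]
    intro α hα
    obtain ⟨β, rfl⟩ := exact_mid _ _ _ (jx_exact x) (jx_inj x) (Submodule.mkQ_surjective _) i α hα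
    rw [hBφ, ← map_map, hB i hi]
  · intro α hα
    have hbij := pi_bij M x d hQ
    obtain ⟨α', rfl⟩ := hbij.2 α
    have hα' : ∀ r ∈ maximalIdeal R, r • α' = 0 := fun r hr => hbij.1 (by
      rw [_root_.map_smul, hα r hr, _root_.map_zero])
    have h0 : map (maximalIdeal R) (d + 1) φ (map (maximalIdeal R) (d + 1) (Ux M x).mkQ α') = 0 := by
      rw [map_map]
      have : φ ∘ₗ (Ux M x).mkQ = ∑ j, a j • LinearMap.single R (fun _ => M) j := by
        refine LinearMap.ext fun u => ?_
        change φ0 u = _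
        funext j
        simp [φ0, LinearMap.sum_apply, Finset.sum_apply, Pi.single_apply]
      rw [this, map_sum]
      refine Finset.sum_eq_zero fun j _ => ?_
      rw [map_smul, ← _root_.map_smul, hα' _ (ham j), _root_.map_zero]
    have hex := LinearMap.exact_map_mkQ_range φ
    have hsurj := Submodule.mkQ_surjective (LinearMap.range φ)
    obtain ⟨β, hβ⟩ := exact_left _ φ _ hex hφ hsurj d _ h0
    let c : ((ι → M) ⧸ LinearMap.range φ) →ₗ[R] QuotSMulTop x M :=
      Submodule.liftQ _ (Submodule.mkQ (x • (⊤ : Submodule R M)) ∘ₗ B) (by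
        rintro _ ⟨u, rfl⟩
        rw [LinearMap.mem_ker, LinearMap.comp_apply, ← LinearMap.comp_apply B φ, ← hBφ]
        exact (jx_exact x _).2 ⟨u, rfl⟩)
    have hc : Submodule.mkQ (x • (⊤ : Submodule R M)) ∘ₗ B = c ∘ₗ (LinearMap.range φ).mkQ :=
      LinearMap.ext fun u => rfl
    refine ⟨map _ d c β, fun r hr => ?_, ?_⟩
    · have h1 : δ (maximalIdeal R) d φ _ hex hφ hsurj (r • β) = 0 := by
        rw [_root_.map_smul, hβ, hα r hr]
      obtain ⟨γ, hγ⟩ := exact_right _ φ _ hex hφ hsurj d _ h1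
      rw [← _root_.map_smul, ← hγ, map_map, ← hc, ← map_map, hB d (by omega), _root_.map_zero]
    · rw [δx, δ_nat (maximalIdeal R) φ _ hex hφ hsurj (jx M x) _ (jx_exact x) (jx_inj x)
        (Submodule.mkQ_surjective _) d LinearMap.id B c (by rw [← hBφ]; rfl) hc, hβ, map_id]

include hM hQ hxm hxb in
lemma step_len : sl R (H (maximalIdeal R) d (QuotSMulTop x M)) =
    sl R (H (maximalIdeal R) d M) + sl R (H (maximalIdeal R) (d + 1) M) := by
  obtain ⟨h1, h2⟩ := step M x d hM hQ hxm hxb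
  rw [sl_equiv (LinearEquiv.ofBijective _ (pi_bij M x d hQ))]
  refine sl_add _ (δx (maximalIdeal R) M x d) (h1 d (by omega)) ?_ ?_ h2
  · intro a; exact δ_map _ _ _ _ _ _ _ _
  · intro b hb; exact exact_right _ _ _ _ _ _ _ _ hb

end D2

section D3
variable {R : Type u} [CommRing R] [IsLocalRing R] [IsNoetherianRing R]

omit [IsNoetherianRing R] in
lemma csop_last {M : Type u} [AddCommGroup M] [Module R M] {d : ℕ} {x : Fin (d + 1) → R}
    (hx : IsCSOP R M (d + 1) x) : x (Fin.last d) ∈ (bIdeal R M (d + 1)) ^ 3 := by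
  have h := hx.2 (Fin.last d)
  have E : (M ⧸ (Ideal.span (x '' {j | Fin.last d < j}) • ⊤ : Submodule R M)) ≃ₗ[R] M :=
    Submodule.quotEquivOfEqBot _ (by
      have : x '' {j | Fin.last d < j} = ∅ := by
        rw [Set.image_eq_empty, Set.eq_empty_iff_forall_notMem]
        intro j hj
        exact absurd hj (not_lt.2 (Fin.le_last j))
      rw [this]; simp)
  rw [b_equiv E] at h
  exact h

omit [IsNoetherianRing R] in
lemma range_last {d : ℕ} (x : Fin (d + 1) → R) : Ideal.span (Set.range x) =
    Ideal.span {x (Fin.last d)} ⊔ Ideal.span (Set.range fun i : Fin d => x i.castSucc) := by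
  rw [← Ideal.span_union]
  congr 1
  ext z
  constructor
  · rintro ⟨j, rfl⟩
    induction j using Fin.lastCases with
    | last => left; rfl
    | cast j => right; exact ⟨j, rfl⟩
  · rintro (rfl | ⟨j, rfl⟩)
    · exact ⟨_, rfl⟩
    · exact ⟨_, rfl⟩

omit [IsNoetherianRing R] in
lemma csop_quot {M : Type u} [AddCommGroup M] [Module R M] {d : ℕ} {x : Fin (d + 1) → R}
    (hx : IsCSOP R M (d + 1) x) :
    IsCSOP R (QuotSMulTop (x (Fin.last d)) M) d (fun i => x i.castSucc) := by
  refine ⟨(sop_quot _ (Submodule.mkQ_surjective _) x _ _ (ker_qs _) hx.1.1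
    (fun i => hx.1.1 i.castSucc) (range_last x)).1 hx.1, fun i => ?_⟩
  have h := hx.2 i.castSucc
  have e : x '' {j | i.castSucc < j} = {x (Fin.last d)} ∪
      (fun i : Fin d => x i.castSucc) '' {j | i < j} := by
    ext z
    constructor
    · rintro ⟨j, hj, rfl⟩
      induction j using Fin.lastCases with
      | last => left; rfl
      | cast j => right; exact ⟨j, by simpa using hj, rfl⟩
    · rintro (rfl | ⟨j, hj, rfl⟩)
      · exact ⟨_, Fin.castSucc_lt_last i, rfl⟩
      · exact ⟨j.castSucc, by simpa using hj, rfl⟩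
  rw [e, Ideal.span_union, b_equiv (quotE _ (Submodule.mkQ_surjective _) _ (ker_qs _) _)] at h
  exact h

lemma main (d : ℕ) : ∀ (M : Type u) [AddCommGroup M] [Module R M] [Module.Finite R M]
    (x : Fin d → R), IsCSOP R M d x →
    sl R (H (maximalIdeal R) d M) ≤ sl R (M ⧸ (Ideal.span (Set.range x) • ⊤ : Submodule R M)) ∧
    (sl R (H (maximalIdeal R) d M) = sl R (M ⧸ (Ideal.span (Set.range x) • ⊤ : Submodule R M)) ↔
      ∀ i < d, ∀ α : H (maximalIdeal R) i M, α = 0) := by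
  induction d with
  | zero =>
    intro M _ _ _ x hx
    have ht := (sop_zero_iff M x).1 hx.1
    have E : (M ⧸ (Ideal.span (Set.range x) • ⊤ : Submodule R M)) ≃ₗ[R] M :=
      Submodule.quotEquivOfEqBot _ (by simp [Set.range_eq_empty])
    have E2 : H (maximalIdeal R) 0 M ≃ₗ[R] M :=
      LinearEquiv.ofBijective (ev _ M) ⟨ev_inj _, fun m => by
        obtain ⟨n, hn⟩ := ht m
        exact ev_range _ m n hn⟩
    have h := sl_equiv (E2.trans E.symm)
    exact ⟨h.le, fun _ i hi => by omega, fun _ => h⟩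
  | succ d ih =>
    intro M _ _ _ x hx
    have hm := hx.1.1 (Fin.last d)
    have hb := csop_last hx
    have hc := csop_quot hx
    have hM := dim_of_sop _ M x hx.1
    have hQ := dim_of_sop _ _ _ hc.1
    have E := quotE _ (Submodule.mkQ_surjective _) _ (ker_qs (M := M) (x (Fin.last d)))
      (Ideal.span (Set.range fun i : Fin d => x i.castSucc))
    rw [← range_last] at E
    obtain ⟨ih1, ih2⟩ := ih _ _ hc
    rw [← sl_equiv E, step_len M _ d hM hQ hm hb] at ih1 ih2
    have hfin := sl_fin hx.1.2
    refine ⟨le_add_self.trans ih1, fun h => ?_, fun h => ?_⟩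
    · have hd0 : sl R (H (maximalIdeal R) d M) = 0 := by
        rw [← h] at ih1 hfin
        by_contra hne
        have : sl R (H (maximalIdeal R) (d + 1) M) <
            sl R (H (maximalIdeal R) d M) + sl R (H (maximalIdeal R) (d + 1) M) := by
          exact ENat.lt_add_left hfin (pos_iff_ne_zero.2 hne)
        exact absurd ih1 (not_le.2 this)
      have h2 := ih2.1 (by rw [hd0, zero_add, h])
      intro i hi α
      rcases Nat.lt_succ_iff_lt_or_eq.1 hi with hi' | rfl
      · apply (step M _ d hM hQ hm hb).1 i hi
        exact (h2 i hi' _).trans (_root_.map_zero _).symm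
      · exact zero_of_sl (fun a => torsion _ _ a) hd0 α
    · have hU : Ux M (x (Fin.last d)) = ⊥ := by
        rw [eq_bot_iff]
        intro u hu
        exact hom_zero d M (Ux M (x (Fin.last d))) h ((dim_Ux M _).trans hQ) (Submodule.subtype _) ⟨u, hu⟩
      have := ih2.2 (van_quot M _ hU d h)
      rwa [sl_zero (h d (by omega)), zero_add] at this
end D3
end LC

/-- `M` is Cohen-Macaulay iff the stable value `N_R(M)` (the common value
`ir_M(q)` for `q` generated by any C-system of parameters) equals `dim_k Soc(H^d_m(M))`. -/
theorem stmt1 (R : Type u) [CommRing R] [IsLocalRing R] [IsNoetherianRing R]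
    (hCM : IsQuotientOfCMLocalRing R)
    (M : Type u) [AddCommGroup M] [Module R M] [Module.Finite R M]
    (d : ℕ) (hd : 0 < d) (hdim : mdim R M = d)
    (x : Fin d → R) (hx : IsCSOP R M d x) :
    IsCM R M ↔ ir R M (Ideal.span (Set.range x)) = socH R M d := by
  obtain ⟨h1, h2⟩ := LC.main d M x hx
  rw [LC.isCM_iff M d hdim, ← h2]
  obtain ⟨d, rfl⟩ := Nat.exists_eq_succ_of_ne_zero hd.ne'
  have hf := LC.sl_fin hx.1.2
  have hE := LC.sl_equiv (LC.lcEquiv (maximalIdeal R) d M)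
  have hf2 := ne_top_of_le_ne_top hf h1
  rw [hE] at hf2 ⊢
  have e1 := LC.sl_socDim hf
  have e2 := LC.sl_socDim hf2
  rw [← e1, ← e2, ir, socH, Nat.cast_inj]
  exact eq_comm
end
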